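/- Let p be a prime with p ≡ 15 (mod 16). Then for every integer n ≥ 2, the 2-class group of L_{n,p} is not cyclic; indeed the 2-rank of the ideal class group of L_{n,p} is at least 2. -/

import Mathlib

open IntermediateField NumberField

/-- The quadratic field `ℚ(√m)` realized inside `ℂ` (for `m` of either sign). -/
noncomputable def quadField (m : ℤ) : IntermediateField ℚ ℂ :=
  IntermediateField.adjoin ℚ {z : ℂ | z ^ 2 = (m : ℂ)}

/-- The 2-class group of a number field `K ⊆ ℂ`: the 2-primary component
(= 2-Sylow subgroup) of the ideal class group of its ring of integers. -/
noncomputable def twoClassGroup (K : IntermediateField ℚ ℂ) :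
    Subgroup (ClassGroup (𝓞 K)) :=
  CommGroup.primaryComponent _ 2

/-- `h₂(m)`: the 2-class number of the quadratic field `ℚ(√m)`. -/
noncomputable def h2 (m : ℤ) : ℕ := Nat.card (twoClassGroup (quadField m))

/-- `L_{n,d} = ℚ(ζ_{2^{n+2}}, √d)`, the `n`-th layer of the cyclotomic
`ℤ₂`-extension of `ℚ(√d, √-1)`. -/
noncomputable def Lfield (n : ℕ) (d : ℤ) : IntermediateField ℚ ℂ :=
  IntermediateField.adjoin ℚ
    ({z : ℂ | z ^ 2 ^ (n + 2) = 1} ∪ {z : ℂ | z ^ 2 = (d : ℂ)})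

/-- `ℚ(ζ_{2^{n+2}} + ζ_{2^{n+2}}⁻¹, √d) = ℚ(2cos(2π/2^{n+2}), √d)`.
For `d > 0` this is the maximal real subfield `L_{n,d}⁺` of `L_{n,d}`;
for `d < 0` it is the `n`-th layer `K_{n,|d|}` of the cyclotomic
`ℤ₂`-extension of the imaginary quadratic field `ℚ(√d)`. -/
noncomputable def LplusField (n : ℕ) (d : ℤ) : IntermediateField ℚ ℂ :=
  IntermediateField.adjoin ℚ
    ({((2 * Real.cos (2 * Real.pi / 2 ^ (n + 2)) : ℝ) : ℂ)} ∪ {z : ℂ | z ^ 2 = (d : ℂ)})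

namespace TwoRank
open scoped nonZeroDivisors

/-- Lift a homomorphism on nonzero ideals killing principal ideals to the class group. -/
theorem exists_lift {S G : Type*} [CommRing S] [IsDedekindDomain S] [CommGroup G]
    (f : (Ideal S)⁰ →* G)
    (hf : ∀ (I : (Ideal S)⁰) (x : S), (I : Ideal S) = Ideal.span {x} → f I = 1) :
    ∃ F : ClassGroup S →* G, ∀ I, F (ClassGroup.mk0 I) = f I := by
  have key : ∀ I J : (Ideal S)⁰, ClassGroup.mk0 I = ClassGroup.mk0 J → f I = f J := by
    intro I J h
    obtain ⟨x, y, hx, hy, h⟩ := ClassGroup.mk0_eq_mk0_iff.1 h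
    have hx' : Ideal.span {x} ∈ (Ideal S)⁰ := by
      rw [mem_nonZeroDivisors_iff_ne_zero]; simpa using hx
    have hy' : Ideal.span {y} ∈ (Ideal S)⁰ := by
      rw [mem_nonZeroDivisors_iff_ne_zero]; simpa using hy
    have : (⟨_, hx'⟩ : (Ideal S)⁰) * I = ⟨_, hy'⟩ * J := Subtype.ext h
    have h2 := congrArg f this
    rw [map_mul, map_mul, hf ⟨_, hx'⟩ x rfl, hf ⟨_, hy'⟩ y rfl, one_mul, one_mul] at h2
    exact h2
  choose g hg using (ClassGroup.mk0_surjective (R := S))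
  refine ⟨⟨⟨fun c => f (g c), ?_⟩, ?_⟩, ?_⟩
  · have := key (g 1) 1 (by rw [hg, map_one])
    rw [this, map_one]
  · intro a b
    have := key (g (a * b)) (g a * g b) (by rw [hg, map_mul, hg, hg])
    simp only [this, map_mul]
  · intro I
    exact key _ _ (hg _)

section abs
variable {R S : Type*} [CommRing R] [CommRing S] [IsDedekindDomain R] [IsDedekindDomain S]
  [Algebra R S] [Module.IsTorsionFree R S]

/-- Galois descent for ideals in an unramified quadratic extension. -/
theorem ideal_descent (σ : S ≃ₐ[R] S) (hσ : ∀ x, σ (σ x) = x)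
    (hfix : ∀ x, σ x = x → ∃ r, algebraMap R S r = x)
    (hD : Ideal.span (Set.range fun w => σ w - w) = ⊤)
    (I : Ideal S) (hI : ∀ x ∈ I, σ x ∈ I) :
    (I.comap (algebraMap R S)).map (algebraMap R S) = I := by
  refine le_antisymm Ideal.map_comap_le ?_
  have tr : ∀ y ∈ I, y + σ y ∈ (I.comap (algebraMap R S)).map (algebraMap R S) := by
    intro y hy
    obtain ⟨r, hr⟩ := hfix (y + σ y) (by rw [map_add, hσ, add_comm])
    rw [← hr]
    apply Ideal.mem_map_of_mem
    rw [Ideal.mem_comap, hr]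
    exact I.add_mem hy (hI _ hy)
  intro x hx
  have : ∀ d ∈ Ideal.span (Set.range fun w => σ w - w),
      d * x ∈ (I.comap (algebraMap R S)).map (algebraMap R S) := by
    intro d hd
    induction hd using Submodule.span_induction with
    | mem d hd =>
      obtain ⟨w, rfl⟩ := hd
      have h1 := tr (w * σ x) (I.mul_mem_left _ (hI _ hx))
      have h2 := Ideal.mul_mem_left _ w (tr (σ x) (hI _ hx))
      rw [map_mul, hσ] at h1
      rw [hσ] at h2
      have := sub_mem h1 h2
      convert this using 1
      ring
    | zero => simp
    | add a b _ _ ha hb => rw [add_mul]; exact add_mem ha hb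
    | smul a b _ hb => rw [smul_eq_mul, mul_assoc]; exact Ideal.mul_mem_left _ _ hb
  have h1 := this 1 (by rw [hD]; trivial)
  rwa [one_mul] at h1

/-- Integral form of Hilbert 90. -/
theorem hilbert90 (σ : S ≃ₐ[R] S) (hσ : ∀ x, σ (σ x) = x) (hne : ∃ w, σ w ≠ w)
    (b c : S) (hc : c ≠ 0) (h : b * σ b = c * σ c) :
    ∃ g : S, g ≠ 0 ∧ b * σ g = σ c * g := by
  obtain ⟨w, hw⟩ := hne
  have key : ∀ w, b * σ (c * w + b * σ w) = σ c * (c * w + b * σ w) := by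
    intro w
    rw [map_add, map_mul, map_mul, hσ]
    linear_combination w * h
  by_cases h1 : c * 1 + b * σ 1 = 0
  · refine ⟨c * w + b * σ w, ?_, key w⟩
    intro h2
    rw [map_one] at h1
    have : c * (σ w - w) = 0 := by linear_combination σ w * h1 - h2
    rcases mul_eq_zero.1 this with h | h
    · exact hc h
    · exact hw (sub_eq_zero.1 h)
  · exact ⟨_, h1, key 1⟩

/-- The fixed subgroup. -/
def plusG {E : Type*} [CommGroup E] (e : E →* E) : Subgroup E where
  carrier := {u | e u = u}
  mul_mem' := by intro a b ha hb; simp_all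
  one_mem' := by simp
  inv_mem' := by intro a ha; simp_all

/-- The norm. -/
def nrmG {E : Type*} [CommGroup E] (e : E →* E) : E →* E := MonoidHom.id E * e
/-- The twisted difference. -/
def difG {E : Type*} [CommGroup E] (e : E →* E) : E →* E := MonoidHom.id E / e

theorem nrmG_apply {E : Type*} [CommGroup E] (e : E →* E) (u : E) : nrmG e u = u * e u := rfl
theorem difG_apply {E : Type*} [CommGroup E] (e : E →* E) (u : E) : difG e u = u / e u := rfl

theorem mem_plusG {E : Type*} [CommGroup E] (e : E →* E) (u : E) : u ∈ plusG e ↔ e u = u := Iff.rfl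

/-- Image of an ideal by the automorphism. -/
noncomputable def conjI (σ : S ≃ₐ[R] S) : Ideal S →* Ideal S where
  toFun I := I.map (σ : S →+* S)
  map_one' := by simp [Ideal.one_eq_top, Ideal.map_top]
  map_mul' I J := Ideal.map_mul _ _ _

theorem conjI_span (σ : S ≃ₐ[R] S) (x : S) : conjI σ (Ideal.span {x}) = Ideal.span {σ x} := by
  simp [conjI, Ideal.map_span]

theorem conjI_conjI (σ : S ≃ₐ[R] S) (hσ : ∀ x, σ (σ x) = x) (I : Ideal S) :
    conjI σ (conjI σ I) = I := by
  simp only [conjI, MonoidHom.coe_mk, OneHom.coe_mk, Ideal.map_map]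
  have : (σ : S →+* S).comp (σ : S →+* S) = RingHom.id S := by
    ext x; simpa using hσ x
  rw [this, Ideal.map_id]

theorem mem_conjI (σ : S ≃ₐ[R] S) (I : Ideal S) {x : S} (hx : x ∈ I) : σ x ∈ conjI σ I :=
  Ideal.mem_map_of_mem (σ : S →+* S) hx

theorem conjI_ne (σ : S ≃ₐ[R] S) (hσ : ∀ x, σ (σ x) = x) (I : Ideal S) (h : I ≠ 0) :
    conjI σ I ≠ 0 := by
  intro h0
  apply h
  rw [← conjI_conjI σ hσ I, h0]
  simp [conjI]

/-- The relation between ambiguous classes and units. -/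
def Rel (σ : S ≃ₐ[R] S) (c : ClassGroup S) (u : Sˣ) : Prop :=
  ∃ (I : (Ideal S)⁰) (x y : S), ClassGroup.mk0 I = c ∧ x ≠ 0 ∧ y ≠ 0 ∧
    Ideal.span {x} * conjI σ I = Ideal.span {y} * I ∧ y * σ y = u * (x * σ x)

theorem span_ne {x : S} (hx : x ≠ 0) : Ideal.span {x} ≠ (0 : Ideal S) := by simpa using hx

theorem Rel.mul {σ : S ≃ₐ[R] S} {c c' : ClassGroup S} {u u' : Sˣ} (h : Rel σ c u)
    (h' : Rel σ c' u') : Rel σ (c * c') (u * u') := by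
  obtain ⟨I, x, y, h1, h2, h3, h4, h5⟩ := h
  obtain ⟨I', x', y', h1', h2', h3', h4', h5'⟩ := h'
  refine ⟨I * I', x * x', y * y', by rw [map_mul, h1, h1'], mul_ne_zero h2 h2', mul_ne_zero h3 h3',
    ?_, ?_⟩
  · rw [← Ideal.span_singleton_mul_span_singleton, ← Ideal.span_singleton_mul_span_singleton,
      Submonoid.coe_mul, map_mul]
    calc _ = (Ideal.span {x} * conjI σ I) * (Ideal.span {x'} * conjI σ I') := by ring
      _ = _ := by rw [h4, h4']; ring
  · rw [map_mul, map_mul, Units.val_mul]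
    calc _ = (y * σ y) * (y' * σ y') := by ring
      _ = _ := by rw [h5, h5']; ring

theorem Rel.inv {σ : S ≃ₐ[R] S} (hσ : ∀ x, σ (σ x) = x) {c : ClassGroup S} {u : Sˣ}
    (h : Rel σ c u) : Rel σ c⁻¹ u⁻¹ := by
  obtain ⟨I, x, y, h1, h2, h3, h4, h5⟩ := h
  obtain ⟨I', hI'⟩ := ClassGroup.mk0_surjective c⁻¹
  rw [← h1] at hI'
  obtain ⟨z, hz, hz'⟩ := ClassGroup.mk0_eq_mk0_inv_iff.1 hI'
  have hσz : σ z ≠ 0 := by simpa using hz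
  refine ⟨I', y * z, x * σ z, by rw [hI', h1], mul_ne_zero h3 hz, mul_ne_zero h2 hσz, ?_, ?_⟩
  · have hne : (I : Ideal S) ≠ 0 := nonZeroDivisors.coe_ne_zero _
    have e2 : conjI σ I' * conjI σ I = Ideal.span {σ z} := by
      rw [← map_mul, hz', conjI_span]
    rw [← Ideal.span_singleton_mul_span_singleton, ← Ideal.span_singleton_mul_span_singleton,
      ← hz', ← e2]
    calc _ = (Ideal.span {y} * I) * (I' * conjI σ I') := by ring
      _ = _ := by rw [← h4]; ring
  · rw [map_mul, map_mul, hσ]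
    have : (u : S) * ((u⁻¹ : Sˣ) : S) = 1 := by simp
    linear_combination (- (u⁻¹ : Sˣ) * z * σ z : S) * h5 - (x * σ x * z * σ z) * this

theorem Rel.exists {σ : S ≃ₐ[R] S} (hσ : ∀ x, σ (σ x) = x) (τ : ClassGroup S →* ClassGroup S)
    (hτ : ∀ I J : (Ideal S)⁰, (J : Ideal S) = conjI σ I → 
      τ (ClassGroup.mk0 I) = ClassGroup.mk0 J)
    (c : ClassGroup S) (hc : τ c = c) :
    ∃ u : Sˣ, Rel σ c u ∧ Units.map (σ : S →* S) u = u := by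
  obtain ⟨I, rfl⟩ := ClassGroup.mk0_surjective c
  have hne : (I : Ideal S) ≠ 0 := nonZeroDivisors.coe_ne_zero _
  have hJ : conjI σ I ∈ (Ideal S)⁰ := mem_nonZeroDivisors_of_ne_zero (conjI_ne σ hσ _ hne)
  rw [hτ I ⟨_, hJ⟩ rfl] at hc
  obtain ⟨x, y, hx, hy, h⟩ := ClassGroup.mk0_eq_mk0_iff.1 hc
  simp only at h
  have h' := congrArg (conjI σ) h
  rw [map_mul, map_mul, conjI_span, conjI_span, conjI_conjI σ hσ] at h'
  have hass : Ideal.span {y * σ y} = Ideal.span {x * σ x} := by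
    rw [← Ideal.span_singleton_mul_span_singleton, ← Ideal.span_singleton_mul_span_singleton]
    have : (I * conjI σ I : Ideal S) ≠ 0 := mul_ne_zero hne (conjI_ne σ hσ _ hne)
    apply mul_right_cancel₀ this
    calc _ = (Ideal.span {y} * I) * (Ideal.span {σ y} * conjI σ I) := by ring
      _ = _ := by rw [← h, ← h']; ring
  rw [Ideal.span_singleton_eq_span_singleton] at hass
  obtain ⟨v, hv⟩ := hass.symm
  have hσx : σ x ≠ 0 := by simpa using hx
  refine ⟨v, ⟨I, x, y, rfl, hx, hy, h, by rw [← hv]; ring⟩, ?_⟩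
  have h2 := congrArg σ hv
  simp only [map_mul, hσ] at h2
  ext
  simp only [Units.coe_map]
  have h3 : x * σ x * (σ v) = x * σ x * v := by rw [hv]; linear_combination h2
  exact mul_left_cancel₀ (mul_ne_zero hx hσx) h3

theorem Rel.extended {σ : S ≃ₐ[R] S} (hσ : ∀ x, σ (σ x) = x) (hne : ∃ w, σ w ≠ w)
    (hfix : ∀ x, σ x = x → ∃ r, algebraMap R S r = x)
    (hD : Ideal.span (Set.range fun w => σ w - w) = ⊤)
    {c : ClassGroup S} {u : Sˣ} (h : Rel σ c u) (hu : u ∈ (nrmG (Units.map (σ : S →* S))).range) :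
    c ∈ (ClassGroup.extendedHom R S).range := by
  obtain ⟨I, x, y, h1, hx, hy, h4, h5⟩ := h
  obtain ⟨v, rfl⟩ := hu
  rw [nrmG_apply] at h5
  simp only [Units.val_mul, Units.coe_map, MonoidHom.coe_coe] at h5
  have hxv : x * v ≠ 0 := mul_ne_zero hx v.ne_zero
  obtain ⟨g, hg, hg2⟩ := hilbert90 σ hσ hne y (x * v) hxv (by
    rw [h5, map_mul]; ring)
  set a := x * v with ha
  have hsp : Ideal.span {a} = Ideal.span {x} := by
    rw [Ideal.span_singleton_eq_span_singleton]
    exact ⟨v⁻¹, by simp [ha]⟩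
  rw [← hsp] at h4
  have hσa : σ a ≠ 0 := by simpa using hxv
  have hσg : σ g ≠ 0 := by simpa using hg
  set K : Ideal S := Ideal.span {σ a * g} * I with hK
  have hK' : K = Ideal.span {a * σ g} * conjI σ I := by
    have : Ideal.span {y} ≠ (0 : Ideal S) := span_ne hy
    apply mul_left_cancel₀ this
    calc _ = Ideal.span {σ a * g} * (Ideal.span {y} * I) := by rw [hK]; ring
      _ = Ideal.span {y * σ g} * (Ideal.span {a} * conjI σ I) := by rw [h4, hg2]
      _ = _ := by
        simp only [← Ideal.span_singleton_mul_span_singleton]; ring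
  have hinv : conjI σ K = K := by
    conv_lhs => rw [hK']
    rw [map_mul, conjI_span, conjI_conjI σ hσ, map_mul, hσ, hK]
  have hKd := ideal_descent σ hσ hfix hD K (fun x hx => hinv ▸ mem_conjI σ K hx)
  have hI0 : (I : Ideal S) ≠ 0 := nonZeroDivisors.coe_ne_zero _
  have hK0 : K ≠ 0 := mul_ne_zero (span_ne (mul_ne_zero hσa hg)) hI0
  have hJ : K.comap (algebraMap R S) ≠ 0 := by
    intro h0
    rw [h0] at hKd
    apply hK0
    rw [← hKd]; simp
  refine ⟨ClassGroup.mk0 ⟨_, mem_nonZeroDivisors_of_ne_zero hJ⟩, ?_⟩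
  rw [ClassGroup.extendedHom_mk0, ← h1, ClassGroup.mk0_eq_mk0_iff]
  refine ⟨1, σ a * g, one_ne_zero, mul_ne_zero hσa hg, ?_⟩
  simp only [ClassGroup.extendedIdeal, hKd, Ideal.span_singleton_one, Ideal.top_mul]
  rfl

theorem kernel_bound {σ : S ≃ₐ[R] S} (hσ : ∀ x, σ (σ x) = x) (hne : ∃ w, σ w ≠ w)
    (hfix : ∀ x, σ x = x → ∃ r, algebraMap R S r = x)
    (hD : Ideal.span (Set.range fun w => σ w - w) = ⊤) [Finite (ClassGroup R)] :
    (difG (Units.map (σ : S →* S))).range.relIndex (nrmG (Units.map (σ : S →* S))).ker ≤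
      Nat.card (ClassGroup.extendedHom R S).ker := by
  set e := Units.map (σ : S →* S) with he
  have hev : ∀ u : Sˣ, ((e u : Sˣ) : S) = σ u := fun u => rfl
  have step : ∀ u : (nrmG e).ker, ∃ (J : (Ideal R)⁰) (g : S), g ≠ 0 ∧ 
      (J : Ideal R).map (algebraMap R S) = Ideal.span {g} ∧ (u : Sˣ) * σ g = g := by
    rintro ⟨u, hu⟩
    rw [MonoidHom.mem_ker, nrmG_apply] at hu
    have hu' := congrArg (Units.val) hu
    rw [Units.val_mul, hev, Units.val_one] at hu'
    obtain ⟨g, hg, hg2⟩ := hilbert90 σ hσ hne u 1 one_ne_zero (by rw [hu']; simp)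
    rw [map_one, one_mul] at hg2
    have hinv : conjI σ (Ideal.span {g}) = Ideal.span {g} := by
      rw [conjI_span, Ideal.span_singleton_eq_span_singleton]
      exact ⟨u, by rw [mul_comm]; exact hg2⟩
    have hKd := ideal_descent σ hσ hfix hD (Ideal.span {g})
      (fun x hx => hinv ▸ mem_conjI σ _ hx)
    have hJ : (Ideal.span {g}).comap (algebraMap R S) ≠ 0 := by
      intro h0
      rw [h0] at hKd
      apply span_ne hg
      rw [← hKd]; simp
    exact ⟨⟨_, mem_nonZeroDivisors_of_ne_zero hJ⟩, g, hg, hKd, hg2⟩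
  choose J g hg hJ hu using step
  have hker : ∀ u, ClassGroup.mk0 (J u) ∈ (ClassGroup.extendedHom R S).ker := by
    intro u
    rw [MonoidHom.mem_ker, ClassGroup.extendedHom_mk0, ClassGroup.mk0_eq_one_iff]
    exact ⟨g u, hJ u⟩
  rw [Subgroup.relIndex, Subgroup.index]
  refine Nat.card_le_card_of_injective
    (fun q : (nrmG e).ker ⧸ (difG e).range.subgroupOf (nrmG e).ker =>
      (⟨_, hker q.out⟩ : (ClassGroup.extendedHom R S).ker)) ?_
  intro q q' h
  have h1 : ClassGroup.mk0 (J q.out) = ClassGroup.mk0 (J q'.out) := congrArg Subtype.val h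
  obtain ⟨x, y, hx, hy, hxy⟩ := ClassGroup.mk0_eq_mk0_iff.1 h1
  have h2 := congrArg (Ideal.map (algebraMap R S)) hxy
  rw [Ideal.map_mul, Ideal.map_mul, hJ, hJ, Ideal.map_span, Ideal.map_span, Set.image_singleton,
    Set.image_singleton, Ideal.span_singleton_mul_span_singleton,
    Ideal.span_singleton_mul_span_singleton, Ideal.span_singleton_eq_span_singleton] at h2
  obtain ⟨v, hv⟩ := h2
  have hv2 := congrArg σ hv
  simp only [map_mul, AlgEquiv.commutes] at hv2
  have hinj := FaithfulSMul.algebraMap_injective R S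
  have hx' : algebraMap R S x ≠ 0 := by
    rwa [Ne, map_eq_zero_iff _ hinj]
  have hy' : algebraMap R S y ≠ 0 := by
    rwa [Ne, map_eq_zero_iff _ hinj]
  have hσg : σ (g q.out) ≠ 0 := by simpa using hg q.out
  have a1 := hu q.out
  have a2 := hu q'.out
  rw [← Quotient.out_eq q, ← Quotient.out_eq q']
  apply QuotientGroup.eq.2
  rw [Subgroup.mem_subgroupOf]
  refine ⟨v, ?_⟩
  rw [difG_apply, div_eq_iff_eq_mul]
  ext
  simp only [Subgroup.coe_mul, InvMemClass.coe_inv, Units.val_mul, hev]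
  set u1 : Sˣ := Subtype.val (Quotient.out q)
  set u2 : Sˣ := Subtype.val (Quotient.out q')
  have h3 : (u1 : S) * v = u2 * σ v := by
    apply mul_left_cancel₀ (mul_ne_zero hx' hσg)
    linear_combination algebraMap R S x * v * a1 + hv - algebraMap R S y * a2 - u2 * hv2
  have h4 : ((u1⁻¹ : Sˣ) : S) * u1 = 1 := by simp
  linear_combination ((u1⁻¹ : Sˣ) : S) * h3 - v * h4

theorem ambiguous_bound {σ : S ≃ₐ[R] S} (hσ : ∀ x, σ (σ x) = x) (hne : ∃ w, σ w ≠ w)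
    (hfix : ∀ x, σ x = x → ∃ r, algebraMap R S r = x)
    (hD : Ideal.span (Set.range fun w => σ w - w) = ⊤)
    (τ : ClassGroup S →* ClassGroup S)
    (hτ : ∀ I J : (Ideal S)⁰, (J : Ideal S) = conjI σ I → 
      τ (ClassGroup.mk0 I) = ClassGroup.mk0 J)
    (h0 : (nrmG (Units.map (σ : S →* S))).range.relIndex (plusG (Units.map (σ : S →* S))) ≠ 0) :
    (ClassGroup.extendedHom R S).range.relIndex (plusG τ) ≤ 
     (nrmG (Units.map (σ : S →* S))).range.relIndex (plusG (Units.map (σ : S →* S))) := by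
  set e := Units.map (σ : S →* S) with he
  have step : ∀ c : plusG τ, ∃ u : plusG e, Rel σ c (u : Sˣ) := by
    rintro ⟨c, hc⟩
    obtain ⟨u, h1, h2⟩ := Rel.exists hσ τ hτ c hc
    exact ⟨⟨u, h2⟩, h1⟩
  choose u hu using step
  rw [Subgroup.relIndex, Subgroup.index, Subgroup.relIndex, Subgroup.index]
  have : Finite (plusG e ⧸ (nrmG e).range.subgroupOf (plusG e)) := 
    Nat.finite_of_card_ne_zero h0
  refine Nat.card_le_card_of_injective
    (fun q : plusG τ ⧸ (ClassGroup.extendedHom R S).range.subgroupOf (plusG τ) =>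
      (QuotientGroup.mk (u q.out) : plusG e ⧸ (nrmG e).range.subgroupOf (plusG e))) ?_
  intro q q' h
  have h1 := QuotientGroup.eq.1 h
  rw [Subgroup.mem_subgroupOf] at h1
  have h2 := ((hu q.out).inv hσ).mul (hu q'.out)
  have h3 := h2.extended hσ hne hfix hD (by simpa using h1)
  rw [← Quotient.out_eq q, ← Quotient.out_eq q']
  apply QuotientGroup.eq.2
  rw [Subgroup.mem_subgroupOf]
  simpa using h3

theorem norm_range_lt {σ : S ≃ₐ[R] S} (hσ : ∀ x, σ (σ x) = x) (hne : ∃ w, σ w ≠ w)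
    (hfix : ∀ x, σ x = x → ∃ r, algebraMap R S r = x)
    (hD : Ideal.span (Set.range fun w => σ w - w) = ⊤)
    [Finite (ClassGroup R)] [Finite (ClassGroup S)]
    (N : ClassGroup S →* ClassGroup R)
    (hN : ∀ I J : (Ideal S)⁰, (J : Ideal S) = conjI σ I → 
      N (ClassGroup.mk0 J) = N (ClassGroup.mk0 I))
    (h0 : (nrmG (Units.map (σ : S →* S))).range.relIndex (plusG (Units.map (σ : S →* S))) ≠ 0)
    (h1 : (difG (Units.map (σ : S →* S))).range.relIndex (nrmG (Units.map (σ : S →* S))).ker =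
      2 * (nrmG (Units.map (σ : S →* S))).range.relIndex (plusG (Units.map (σ : S →* S)))) :
    N.range ≠ ⊤ := by
  have hcm : ∀ I : (Ideal S)⁰, conjI σ I ∈ (Ideal S)⁰ := fun I =>
    mem_nonZeroDivisors_of_ne_zero (conjI_ne σ hσ _ (nonZeroDivisors.coe_ne_zero _))
  obtain ⟨τ, hτ⟩ := exists_lift (S := S) (G := ClassGroup S)
    (ClassGroup.mk0.comp ⟨⟨fun I : (Ideal S)⁰ => (⟨conjI σ I, hcm I⟩ : (Ideal S)⁰),
      by ext1; exact map_one (conjI σ)⟩, by intro I J; ext1; simp⟩) (by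
      intro I x hI
      simp only [MonoidHom.coe_comp, Function.comp_apply, MonoidHom.coe_mk, OneHom.coe_mk]
      rw [ClassGroup.mk0_eq_one_iff, hI, conjI_span]
      exact ⟨_, rfl⟩)
  have hτ' : ∀ I J : (Ideal S)⁰, (J : Ideal S) = conjI σ I → 
      τ (ClassGroup.mk0 I) = ClassGroup.mk0 J := by
    intro I J h
    rw [hτ]
    simp only [MonoidHom.coe_comp, Function.comp_apply, MonoidHom.coe_mk, OneHom.coe_mk]
    congr 1
    exact Subtype.ext h.symm
  have b1 := ambiguous_bound hσ hne hfix hD τ hτ' h0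
  have b2 := kernel_bound hσ hne hfix hD
  rw [h1] at b2
  set a := (nrmG (Units.map (σ : S →* S))).range.relIndex (plusG (Units.map (σ : S →* S)))
  -- image of the norm
  have c1 : (difG τ).range ≤ N.ker := by
    rintro _ ⟨c, rfl⟩
    obtain ⟨I, rfl⟩ := ClassGroup.mk0_surjective c
    rw [MonoidHom.mem_ker, difG_apply, map_div, hτ' I ⟨_, hcm I⟩ rfl, hN I ⟨_, hcm I⟩ rfl, div_self']
  have c2 : (difG τ).ker = plusG τ := by
    ext c
    rw [MonoidHom.mem_ker, difG_apply, div_eq_one, mem_plusG, eq_comm]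
  have c3 : Nat.card N.range * Nat.card N.ker = Nat.card (ClassGroup S) := by
    rw [← Subgroup.index_ker, mul_comm]; exact N.ker.card_mul_index
  have c4 : Nat.card (difG τ).range * Nat.card (plusG τ) = Nat.card (ClassGroup S) := by
    rw [← c2, ← Subgroup.index_ker, mul_comm]; exact (difG τ).ker.card_mul_index
  have c5 : Nat.card (difG τ).range ≤ Nat.card N.ker := Subgroup.card_le_of_le c1
  have c6 : Nat.card N.range ≤ Nat.card (plusG τ) := by
    have : 0 < Nat.card (difG τ).range := Nat.card_pos
    by_contra! hlt
    have := Nat.mul_lt_mul_of_lt_of_le hlt c5 (Nat.card_pos)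
    rw [mul_comm (Nat.card (plusG τ)), c4, c3] at this
    exact lt_irrefl _ this
  have c7 : (ClassGroup.extendedHom R S).range ≤ plusG τ := by
    rintro _ ⟨c, rfl⟩
    obtain ⟨I, rfl⟩ := ClassGroup.mk0_surjective c
    rw [ClassGroup.extendedHom_mk0, mem_plusG]
    apply hτ'
    simp only [conjI, MonoidHom.coe_mk, OneHom.coe_mk, ClassGroup.extendedIdeal, Ideal.map_map]
    congr 1
    ext x; simp
  have c8 : Nat.card (ClassGroup.extendedHom R S).range *
      (ClassGroup.extendedHom R S).range.relIndex (plusG τ) = Nat.card (plusG τ) :=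
    by simpa [Subgroup.relIndex_bot_left] using Subgroup.relIndex_mul_relIndex ⊥ _ _ bot_le c7
  have c9 : Nat.card (ClassGroup.extendedHom R S).range * Nat.card (ClassGroup.extendedHom R S).ker
      = Nat.card (ClassGroup R) := by
    rw [← Subgroup.index_ker, mul_comm]; exact (ClassGroup.extendedHom R S).ker.card_mul_index
  intro htop
  rw [htop, Subgroup.card_top] at c6
  have p1 : 0 < Nat.card (ClassGroup.extendedHom R S).range := Nat.card_pos
  have p2 : 0 < a := Nat.pos_of_ne_zero h0
  nlinarith [Nat.mul_le_mul_left (Nat.card (ClassGroup.extendedHom R S).range) b1,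
    Nat.mul_le_mul_left (Nat.card (ClassGroup.extendedHom R S).range) b2]

end abs
end TwoRank

namespace TwoRank
open scoped nonZeroDivisors

theorem fgq_prod (n : ℕ) (T : Type*) [AddCommGroup T] [Finite T] :
    (zsmulAddGroupHom 2 : ((Fin n →₀ ℤ) × T) →+ _).range.index =
      2 ^ n * Nat.card (zsmulAddGroupHom 2 : ((Fin n →₀ ℤ) × T) →+ _).ker := by
  have e1 : (zsmulAddGroupHom 2 : ((Fin n →₀ ℤ) × T) →+ _) =
     AddMonoidHom.prodMap (zsmulAddGroupHom 2) (zsmulAddGroupHom 2) := by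
    ext x <;> simp
  rw [e1, AddMonoidHom.range_prodMap, AddMonoidHom.ker_prodMap, AddSubgroup.index_prod]
  have k0 : (zsmulAddGroupHom 2 : (Fin n →₀ ℤ) →+ _).ker = ⊥ := by
    ext x
    simp
  have k1 : Nat.card ((zsmulAddGroupHom 2 : (Fin n →₀ ℤ) →+ _).ker.prod
      (zsmulAddGroupHom 2 : T →+ _).ker) = Nat.card (zsmulAddGroupHom 2 : T →+ _).ker := by
    rw [Nat.card_congr (AddSubgroup.prodEquiv _ _).toEquiv, Nat.card_prod, k0]
    simp
  have k2 : (zsmulAddGroupHom 2 : T →+ _).range.index = Nat.card (zsmulAddGroupHom 2 : T →+ _).ker := by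
    have h1 := (zsmulAddGroupHom 2 : T →+ _).range.card_mul_index
    have h2 := (zsmulAddGroupHom 2 : T →+ _).ker.card_mul_index
    rw [AddSubgroup.index_ker, ← h1, mul_comm] at h2
    exact (Nat.eq_of_mul_eq_mul_left Nat.card_pos h2).symm
  let g : (Fin n →₀ ℤ) →+ (Fin n → ZMod 2) :=
    { toFun := fun x i => (x i : ZMod 2), map_zero' := by ext; simp, map_add' := by intros; ext; simp }
  have hg : Function.Surjective g := by
    intro y
    refine ⟨Finsupp.equivFunOnFinite.symm fun i => (y i).val, ?_⟩
    ext i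
    simp [g]
  have k3 : (zsmulAddGroupHom 2 : (Fin n →₀ ℤ) →+ _).range = g.ker := by
    ext x
    rw [AddMonoidHom.mem_ker]
    constructor
    · rintro ⟨y, rfl⟩
      ext i
      simp [g]
      left; rfl
    · intro h
      refine ⟨Finsupp.equivFunOnFinite.symm fun i => x i / 2, ?_⟩
      ext i
      have := congrFun h i
      simp only [g, AddMonoidHom.coe_mk, ZeroHom.coe_mk, Pi.zero_apply] at this
      have := (ZMod.intCast_zmod_eq_zero_iff_dvd _ 2).1 this
      simp
      omega
  rw [k1, k2, k3, AddSubgroup.index_ker, AddMonoidHom.range_eq_top.2 hg]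
  simp

theorem fgq_aux (A : Type*) [AddCommGroup A] [Module.Finite ℤ A] (n : ℕ) (T : Type*)
    [AddCommGroup T] [Finite T] (f : A ≃+ (Fin n →₀ ℤ) × T) :
    (zsmulAddGroupHom 2 : A →+ A).range.index =
      2 ^ Module.finrank ℤ A * Nat.card (zsmulAddGroupHom 2 : A →+ A).ker := by
  have h1 : Module.finrank ℤ A = n := by
    have hs : Function.Surjective (LinearMap.fst ℤ (Fin n →₀ ℤ) T) := Prod.fst_surjective
    have h2 := Submodule.finrank_quotient_add_finrank (LinearMap.ker (LinearMap.fst ℤ (Fin n →₀ ℤ) T))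
    have h3 : Module.finrank ℤ (LinearMap.ker (LinearMap.fst ℤ (Fin n →₀ ℤ) T)) = 0 := by
      apply Module.finrank_eq_zero_of_rank_eq_zero
      rw [rank_eq_zero_iff]
      rintro ⟨⟨x, t⟩, hx⟩
      refine ⟨Nat.card T, by exact_mod_cast Nat.card_pos.ne', ?_⟩
      have hx : x = 0 := hx
      subst hx
      ext1
      ext1
      · simp
      · simp
    rw [h3, (LinearMap.quotKerEquivOfSurjective _ hs).finrank_eq, add_zero] at h2
    rw [f.toIntLinearEquiv.finrank_eq, ← h2]
    simp
  have h2 : (zsmulAddGroupHom 2 : ((Fin n →₀ ℤ) × T) →+ _).range = 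
      (zsmulAddGroupHom 2 : A →+ A).range.map (f : A →+ _) := by
    ext x
    constructor
    · rintro ⟨y, rfl⟩
      exact ⟨2 • f.symm y, ⟨f.symm y, by simp [two_nsmul, two_zsmul]⟩, by simp [two_nsmul, two_zsmul]⟩
    · rintro ⟨_, ⟨y, rfl⟩, rfl⟩
      exact ⟨f y, by simp⟩
  have h3 : Nat.card (zsmulAddGroupHom 2 : ((Fin n →₀ ℤ) × T) →+ _).ker = 
      Nat.card (zsmulAddGroupHom 2 : A →+ A).ker := by
    symm
    refine Nat.card_congr (f.toEquiv.subtypeEquiv ?_)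
    intro a
    simp only [AddMonoidHom.mem_ker, zsmulAddGroupHom_apply]
    change _ ↔ (2 : ℤ) • f a = 0
    rw [← map_zsmul, map_eq_zero_iff _ f.injective]
  have h4 := fgq_prod n T
  rw [h2, AddSubgroup.index_map_equiv, h3] at h4
  rw [h4, h1]

theorem fgq (A : Type*) [AddCommGroup A] [Module.Finite ℤ A] :
    (zsmulAddGroupHom 2 : A →+ A).range.index =
      2 ^ Module.finrank ℤ A * Nat.card (zsmulAddGroupHom 2 : A →+ A).ker := by
  have : AddGroup.FG A := Module.Finite.iff_addGroup_fg.mp inferInstance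
  obtain ⟨n, ι, _, p, hp, e, ⟨f⟩⟩ := AddCommGroup.equiv_free_prod_directSum_zmod A
  have : ∀ i, NeZero (p i ^ e i) := fun i => ⟨pow_ne_zero _ (hp i).ne_zero⟩
  classical
  have hfin : Finite (DirectSum ι fun i : ι => ZMod (p i ^ e i)) :=
    Finite.of_equiv _ (DirectSum.addEquivProd fun i : ι => ZMod (p i ^ e i)).symm.toEquiv
  exact fgq_aux A n _ f

theorem relIndex_sq {E : Type*} [CommGroup E] (H : Subgroup E) [Module.Finite ℤ (Additive H)]
    (m : E) (hm : m ≠ 1) (h2 : ∀ x : E, x ^ 2 = 1 ↔ x = 1 ∨ x = m) (hmH : m ∈ H) :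
    (H.map (powMonoidHom 2)).relIndex H = 2 ^ (Module.finrank ℤ (Additive H) + 1) := by
  have h3 : (H.map (powMonoidHom 2)).subgroupOf H = (powMonoidHom 2 : H →* H).range := by
    ext x
    rw [Subgroup.mem_subgroupOf]
    constructor
    · rintro ⟨y, hy, h⟩
      exact ⟨⟨y, hy⟩, Subtype.ext h⟩
    · rintro ⟨y, rfl⟩
      exact ⟨y, y.2, rfl⟩
  have h4 : (powMonoidHom 2 : H →* H).range.toAddSubgroup = 
      (zsmulAddGroupHom 2 : Additive H →+ Additive H).range := by
    ext x
    constructor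
    · rintro ⟨y, hy⟩
      exact ⟨Additive.ofMul y, by
        rw [zsmulAddGroupHom_apply, two_zsmul]
        exact ((sq y).symm.trans hy : y * y = x)⟩
    · rintro ⟨y, hy⟩
      exact ⟨y.toMul, by
        rw [zsmulAddGroupHom_apply, two_zsmul] at hy
        exact (sq y.toMul).trans hy⟩
  have h5 : Nat.card (zsmulAddGroupHom 2 : Additive H →+ Additive H).ker = 2 := by
    rw [Nat.card_eq_two_iff]
    have key : ∀ x : Additive H, x ∈ (zsmulAddGroupHom 2 : Additive H →+ Additive H).ker ↔
        ((x.toMul : H) : E) ^ 2 = 1 := by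
      intro x
      rw [AddMonoidHom.mem_ker, zsmulAddGroupHom_apply, two_zsmul, sq]
      exact ⟨fun h => congrArg Subtype.val (congrArg Additive.toMul h), fun h => 
        Additive.toMul.injective (Subtype.ext h)⟩
    refine ⟨⟨0, zero_mem _⟩, ⟨Additive.ofMul ⟨m, hmH⟩, (key _).2 ((h2 m).2 (Or.inr rfl))⟩, ?_, ?_⟩
    · intro h
      have := congrArg (fun x => ((x.1.toMul : H) : E)) h
      exact hm this.symm
    · ext ⟨x, hx⟩
      simp only [Set.mem_insert_iff, Set.mem_singleton_iff, Set.mem_univ, iff_true, Subtype.mk.injEq]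
      rcases (h2 _).1 ((key x).1 hx) with h | h
      · left; exact Additive.toMul.injective (Subtype.ext h)
      · right; exact Additive.toMul.injective (Subtype.ext h)
  rw [Subgroup.relIndex, h3, ← Subgroup.index_toAddSubgroup, h4, fgq, h5, pow_succ]

theorem herbrand {E : Type*} [CommGroup E] [Module.Finite ℤ (Additive E)] (e : E →* E)
    (he : ∀ x, e (e x) = x) (m : E) (hm : m ≠ 1) (hem : e m = m)
    (h2 : ∀ x : E, x ^ 2 = 1 ↔ x = 1 ∨ x = m)
    (r : ℕ) (hP : Module.finrank ℤ (Additive (plusG e)) = r)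
    (hE : Module.finrank ℤ (Additive E) = 2 * r + 1) :
    (nrmG e).range.relIndex (plusG e) ≠ 0 ∧
    (difG e).range.relIndex (nrmG e).ker = 2 * (nrmG e).range.relIndex (plusG e) := by
  have fin : ∀ H : Subgroup E, Module.Finite ℤ (Additive H) := by
    intro H
    let f : Additive H →ₗ[ℤ] Additive E := H.subtype.toAdditive.toIntLinearMap
    exact Module.Finite.of_injective f (fun x y h => Subtype.ext h)
  have n1 : (plusG e).map (nrmG e) = (plusG e).map (powMonoidHom 2) := by
    ext x
    constructor
    · rintro ⟨y, hy, rfl⟩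
      exact ⟨y, hy, by rw [nrmG_apply, (mem_plusG e y).1 hy, powMonoidHom_apply, sq]⟩
    · rintro ⟨y, hy, rfl⟩
      exact ⟨y, hy, by rw [nrmG_apply, (mem_plusG e y).1 hy, powMonoidHom_apply, sq]⟩
  have inv : ∀ y ∈ (nrmG e).ker, e y = y⁻¹ := by
    intro y hy
    rw [MonoidHom.mem_ker, nrmG_apply] at hy
    exact (inv_eq_of_mul_eq_one_right hy).symm
  have n2 : (nrmG e).ker.map (difG e) = (nrmG e).ker.map (powMonoidHom 2) := by
    ext x
    constructor
    · rintro ⟨y, hy, rfl⟩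
      exact ⟨y, hy, by rw [difG_apply, inv y hy, powMonoidHom_apply, sq, div_inv_eq_mul]⟩
    · rintro ⟨y, hy, rfl⟩
      exact ⟨y, hy, by rw [difG_apply, inv y hy, powMonoidHom_apply, sq, div_inv_eq_mul]⟩
  have c2 : (difG e).ker = plusG e := by
    ext c
    rw [MonoidHom.mem_ker, difG_apply, div_eq_one, mem_plusG, eq_comm]
  have m1 : m ∈ plusG e := hem
  have m2 : m ∈ (nrmG e).ker := by
    rw [MonoidHom.mem_ker, nrmG_apply, hem, ← sq]
    exact (h2 m).2 (Or.inr rfl)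
  have q1 := relIndex_sq (plusG e) m hm h2 m1
  have q2 := relIndex_sq (nrmG e).ker m hm h2 m2
  have d1 : (nrmG e).range ≤ plusG e := by
    rintro _ ⟨y, rfl⟩
    rw [mem_plusG, nrmG_apply, map_mul, he, mul_comm]
  have d2 : (difG e).range ≤ (nrmG e).ker := by
    rintro _ ⟨y, rfl⟩
    rw [MonoidHom.mem_ker, nrmG_apply, difG_apply, map_div, he]
    simp
  have s1 : (plusG e).map (nrmG e) ≤ (nrmG e).range := Subgroup.map_le_range _ _
  have s2 : (nrmG e).ker.map (difG e) ≤ (difG e).range := Subgroup.map_le_range _ _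
  have r1 : ((plusG e).map (nrmG e)).relIndex (nrmG e).range = (plusG e ⊔ (nrmG e).ker).index := by
    rw [MonoidHom.range_eq_map, Subgroup.relIndex_map_map, top_sup_eq, Subgroup.relIndex_top_right]
  have r2 : ((nrmG e).ker.map (difG e)).relIndex (difG e).range = (plusG e ⊔ (nrmG e).ker).index := by
    rw [MonoidHom.range_eq_map, Subgroup.relIndex_map_map, top_sup_eq, Subgroup.relIndex_top_right,
      c2, sup_comm]
  have t1 := Subgroup.relIndex_mul_relIndex _ _ _ s1 d1
  have t2 := Subgroup.relIndex_mul_relIndex _ _ _ s2 d2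
  rw [r1, n1, q1, hP] at t1
  rw [r2, n2, q2] at t2
  have hK : Module.finrank ℤ (Additive (nrmG e).ker) = r + 1 := by
    let d : Additive E →ₗ[ℤ] Additive (nrmG e).ker :=
      ((difG e).codRestrict (nrmG e).ker (fun y => d2 ⟨y, rfl⟩)).toAdditive.toIntLinearMap
    have a1 := Submodule.finrank_quotient_add_finrank (LinearMap.ker d)
    rw [d.quotKerEquivRange.finrank_eq] at a1
    have a2 := Submodule.finrank_quotient_add_finrank (LinearMap.range d)
    have a3 : Module.finrank ℤ (Additive (nrmG e).ker ⧸ LinearMap.range d) = 0 := by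
      apply Module.finrank_eq_zero_of_rank_eq_zero
      rw [rank_eq_zero_iff]
      intro x
      obtain ⟨y, rfl⟩ := Submodule.Quotient.mk_surjective _ x
      refine ⟨2, by norm_num, ?_⟩
      rw [← Submodule.Quotient.mk_smul, Submodule.Quotient.mk_eq_zero, two_zsmul]
      refine ⟨Additive.ofMul ((y.toMul : (nrmG e).ker) : E), ?_⟩
      apply Additive.toMul.injective
      apply Subtype.ext
      change difG e _ = _ * _
      rw [difG_apply]
      erw [inv _ (y.toMul).2]
      rw [div_inv_eq_mul]
      rfl
    have hmk : ∀ x : Additive E, x ∈ LinearMap.ker d ↔ x.toMul ∈ plusG e := by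
      intro x
      rw [LinearMap.mem_ker, ← c2, MonoidHom.mem_ker]
      exact ⟨fun h => congrArg Subtype.val (congrArg Additive.toMul h), fun h => 
        Additive.toMul.injective (Subtype.ext h)⟩
    let q : Additive (plusG e) ≃+ LinearMap.ker d :=
      { toFun := fun x => ⟨Additive.ofMul ((x.toMul : plusG e) : E), (hmk _).2 (x.toMul).2⟩
        invFun := fun x => Additive.ofMul ⟨x.1.toMul, (hmk _).1 x.2⟩
        left_inv := fun x => rfl
        right_inv := fun x => rfl
        map_add' := fun x y => rfl }
    rw [← q.toIntLinearEquiv.finrank_eq, hP, hE] at a1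
    omega
  rw [hK] at t2
  set x := (plusG e ⊔ (nrmG e).ker).index
  have hx : x ≠ 0 := by
    rintro h
    rw [h, zero_mul] at t1
    exact pow_ne_zero _ two_ne_zero t1.symm
  constructor
  · rintro h
    rw [h, mul_zero] at t1
    exact pow_ne_zero _ two_ne_zero t1.symm
  · apply Nat.eq_of_mul_eq_mul_left (Nat.pos_of_ne_zero hx)
    rw [t2, pow_succ, ← t1]; ring

end TwoRank

namespace TwoRank
open scoped nonZeroDivisors

theorem ideal_sq_inj {R : Type*} [CommRing R] [IsDedekindDomain R] {I J : Ideal R}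
    (h : I ^ 2 = J ^ 2) : I = J :=
  dvd_antisymm ((UniqueFactorizationMonoid.pow_dvd_pow_iff_dvd two_ne_zero).1 h.dvd)
    ((UniqueFactorizationMonoid.pow_dvd_pow_iff_dvd two_ne_zero).1 h.symm.dvd)

section main
variable {L M : Type*} [Field L] [NumberField L] [Field M] [NumberField M] [Algebra L M]

/-- integrality of a root of a monic quadratic polynomial -/
theorem isIntegral_quad (z : M) (b c : 𝓞 L)
    (h : z ^ 2 = algebraMap L M b * z + algebraMap L M c) : IsIntegral ℤ z := by
  have : IsIntegral (𝓞 L) z := by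
    refine ⟨Polynomial.X ^ 2 - (Polynomial.C b * Polynomial.X + Polynomial.C c), ?_, ?_⟩
    · refine Polynomial.monic_X_pow_sub (n := 2) ?_
      exact lt_of_le_of_lt Polynomial.degree_linear_le (by norm_num)
    · simp only [Polynomial.eval₂_sub, Polynomial.eval₂_pow, Polynomial.eval₂_X,
        Polynomial.eval₂_add, Polynomial.eval₂_mul, Polynomial.eval₂_C]
      rw [h]
      simp [IsScalarTower.algebraMap_apply (𝓞 L) L M]
  exact isIntegral_trans z this

theorem herbrand_units [IsTotallyComplex L] (hfr : Module.finrank L M = 2)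
    (σ : 𝓞 M ≃ₐ[𝓞 L] 𝓞 M) (hσ : ∀ x, σ (σ x) = x)
    (hfix : ∀ x, σ x = x → ∃ r, algebraMap (𝓞 L) (𝓞 M) r = x) :
    (nrmG (Units.map (σ : 𝓞 M →* 𝓞 M))).range.relIndex (plusG (Units.map (σ : 𝓞 M →* 𝓞 M))) ≠ 0 ∧
    (difG (Units.map (σ : 𝓞 M →* 𝓞 M))).range.relIndex (nrmG (Units.map (σ : 𝓞 M →* 𝓞 M))).ker =
      2 * (nrmG (Units.map (σ : 𝓞 M →* 𝓞 M))).range.relIndex (plusG (Units.map (σ : 𝓞 M →* 𝓞 M))) := by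
  have : IsTotallyComplex M := isTotallyComplex_of_algebra L M
  have f1 := Units.finrank_eq L
  have f2 := Units.finrank_eq M
  have g1 := IsTotallyComplex.finrank L
  have g2 := IsTotallyComplex.finrank M
  have g3 := Module.finrank_mul_finrank ℚ L M
  have c1 := InfinitePlace.card_eq_nrRealPlaces_add_nrComplexPlaces L
  have c2 := InfinitePlace.card_eq_nrRealPlaces_add_nrComplexPlaces M
  have z1 := IsTotallyComplex.nrRealPlaces_eq_zero L
  have z2 := IsTotallyComplex.nrRealPlaces_eq_zero M
  have pos : 0 < Module.finrank ℚ L := Module.finrank_pos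
  rw [Units.rank] at f1 f2
  have hinj := FaithfulSMul.algebraMap_injective (𝓞 L) (𝓞 M)
  refine herbrand (Units.map (σ : 𝓞 M →* 𝓞 M)) (fun x => by ext1; simp [hσ]) (-1) ?_ ?_ ?_
    (Module.finrank ℤ (Additive (𝓞 L)ˣ)) ?_ ?_
  · intro h
    have h := congrArg Units.val h
    simp only [Units.val_neg, Units.val_one] at h
    have : (2 : 𝓞 M) = 0 := by linear_combination -h
    norm_num at this
  · ext1; simp
  · intro x
    constructor
    · intro h
      have h := congrArg Units.val h
      simp only [Units.val_pow_eq_pow_val, Units.val_one] at h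
      rcases mul_self_eq_one_iff.1 ((sq _).symm.trans h) with h | h
      · left; ext1; simpa using h
      · right; ext1; simpa using h
    · rintro (rfl | rfl) <;> simp
  · let q : (𝓞 L)ˣ →* plusG (Units.map (σ : 𝓞 M →* 𝓞 M)) :=
      (Units.map (algebraMap (𝓞 L) (𝓞 M) : 𝓞 L →* 𝓞 M)).codRestrict _ (by
        intro u
        rw [mem_plusG]
        ext1
        simp)
    have hq : Function.Bijective q := by
      constructor
      · intro u v h
        have h := congrArg Units.val (congrArg Subtype.val h)
        ext1
        exact hinj h
      · rintro ⟨u, hu⟩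
        rw [mem_plusG] at hu
        obtain ⟨r, hr⟩ := hfix u (by simpa using congrArg Units.val hu)
        obtain ⟨t, ht⟩ := hfix (u⁻¹ : (𝓞 M)ˣ) (by
          have := congrArg (fun x : (𝓞 M)ˣ => ((x⁻¹ : (𝓞 M)ˣ) : 𝓞 M)) hu
          simpa [← map_inv] using this)
        have h1 : r * t = 1 := by
          apply hinj
          rw [map_mul, hr, ht, map_one, Units.mul_inv]
        refine ⟨⟨r, t, h1, by rw [mul_comm, h1]⟩, ?_⟩
        ext1; ext1
        exact hr
    exact (MulEquiv.toAdditive (MulEquiv.ofBijective q hq)).toIntLinearEquiv.finrank_eq.symm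
  · rw [hfr] at g3
    omega

theorem main_abs [IsTotallyComplex L] (hfr : Module.finrank L M = 2)
    (σ₀ : M ≃ₐ[L] M) (α : 𝓞 M) (hα : σ₀ α = -(α : M))
    (hgen : ∀ m : M, ∃ x y : L, m = algebraMap L M x + algebraMap L M y * α)
    (a s : 𝓞 L) (hαa : α ^ 2 = algebraMap (𝓞 L) (𝓞 M) a) (ha : a ≠ 0) (h4 : 4 ∣ a - s ^ 2)
    (I : Ideal (𝓞 L)) (hI : Ideal.span {a} = I ^ 2) (hc : IsCoprime a 2) :
    ∃ H : Subgroup (ClassGroup (𝓞 L)), H ≠ ⊤ ∧ (∀ c, c ^ 2 ∈ H) ∧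
      ∀ l : (Ideal (𝓞 L))⁰, (l : Ideal (𝓞 L)).IsPrime → 2 * a ∉ (l : Ideal (𝓞 L)) →
        (∃ x, a - x ^ 2 ∈ (l : Ideal (𝓞 L))) → ClassGroup.mk0 l ∈ H := by
  have hinj := FaithfulSMul.algebraMap_injective (𝓞 L) (𝓞 M)
  have hα0 : α ≠ 0 := by
    rintro rfl
    apply ha
    apply hinj
    rw [← hαa]; simp
  have hσ₀ : ∀ x, σ₀ (σ₀ x) = x := by
    intro m
    obtain ⟨x, y, rfl⟩ := hgen m
    simp [hα]
  let σ : 𝓞 M ≃ₐ[𝓞 L] 𝓞 M := RingOfIntegers.mapAlgEquiv σ₀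
  have hσv : ∀ x : 𝓞 M, ((σ x : 𝓞 M) : M) = σ₀ x := fun x => rfl
  have hσ : ∀ x, σ (σ x) = x := by
    intro x
    apply RingOfIntegers.ext
    rw [hσv, hσv, hσ₀]
  have hσα : σ α = -α := by
    apply RingOfIntegers.ext
    rw [hσv, hα]; rfl
  have hne : ∃ w, σ w ≠ w := by
    refine ⟨α, ?_⟩
    rw [hσα]
    intro h
    apply hα0
    have : (2 : 𝓞 M) * α = 0 := by linear_combination -h
    simpa using this
  have hfix : ∀ x, σ x = x → ∃ r, algebraMap (𝓞 L) (𝓞 M) r = x := by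
    intro x hx
    obtain ⟨y, z, hyz⟩ := hgen x
    have h1 := congrArg (algebraMap (𝓞 M) M) hx
    change σ₀ (x : M) = (x : M) at h1
    rw [hyz, map_add, map_mul, AlgEquiv.commutes, AlgEquiv.commutes, hα] at h1
    have h2 : (2 : M) * (algebraMap L M z * α) = 0 := by linear_combination -h1
    have h3 : algebraMap L M z * α = 0 := by simpa using h2
    rw [h3, add_zero] at hyz
    have h4 : IsIntegral ℤ y := by
      rw [← isIntegral_algebraMap_iff (FaithfulSMul.algebraMap_injective L M), ← hyz]
      exact x.isIntegral_coe
    refine ⟨⟨y, h4⟩, ?_⟩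
    apply RingOfIntegers.ext
    rw [hyz]
    rfl
  have hD : Ideal.span (Set.range fun w => σ w - w) = ⊤ := by
    set D := Ideal.span (Set.range fun w => σ w - w) with hDdef
    have hDm : ∀ w, σ w - w ∈ D := fun w => Ideal.subset_span ⟨w, rfl⟩
    obtain ⟨c, hc4⟩ := h4
    have hcM := congrArg (algebraMap (𝓞 L) M) hc4
    have haM : (α : M) ^ 2 = algebraMap (𝓞 L) M a := by
      have := congrArg (algebraMap (𝓞 M) M) hαa
      rw [map_pow] at this
      exact this
    simp only [map_sub, map_pow, map_mul, map_ofNat] at hcM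
    have hω : IsIntegral ℤ ((algebraMap (𝓞 L) M s + (α : M)) / 2) := by
      apply isIntegral_quad (L := L) _ s c
      change _ = algebraMap (𝓞 L) M s * _ + algebraMap (𝓞 L) M c
      linear_combination (1 / 4) * haM + (1 / 4) * hcM
    have d1 : α ∈ D := by
      obtain ⟨ω, hωv⟩ : ∃ ω : 𝓞 M, (ω : M) = (algebraMap (𝓞 L) M s + (α : M)) / 2 := ⟨⟨_, hω⟩, rfl⟩
      have h1 := hDm ω
      have h2 : σ ω - ω = - α := by
        apply RingOfIntegers.ext
        change σ₀ (ω : M) - (ω : M) = -(α : M)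
        rw [hωv, map_div₀, map_add, hα, map_ofNat]
        have e1 : σ₀ (algebraMap (𝓞 L) M s) = algebraMap (𝓞 L) M s := σ₀.commutes s
        rw [e1]
        ring
      rw [h2] at h1
      simpa using h1
    have d2 : algebraMap (𝓞 L) (𝓞 M) a ∈ D := by
      rw [← hαa, sq]; exact D.mul_mem_left _ d1
    have d3 : (4 : 𝓞 M) ∈ D := by
      have hI0 : I ≠ ⊥ := by
        rintro rfl
        apply ha
        rw [← Ideal.span_singleton_eq_bot, hI]
        simp
      obtain ⟨d, hdI, hd0⟩ := Submodule.exists_mem_ne_zero_of_ne_bot hI0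
      obtain ⟨J, hJ⟩ := Ideal.dvd_span_singleton.2 hdI
      have hd0M : algebraMap (𝓞 L) M d ≠ 0 := by
        rw [Ne, map_eq_zero_iff _ (FaithfulSMul.algebraMap_injective (𝓞 L) M)]
        exact hd0
      have hJ2 : Ideal.span {d ^ 2} = Ideal.span {a} * J ^ 2 := by
        rw [hI, ← mul_pow, ← hJ, Ideal.span_singleton_pow]
      have b1 : ∀ j ∈ J, ∃ w : 𝓞 M, w ∈ D ∧ 
          algebraMap (𝓞 L) (𝓞 M) d * w = algebraMap (𝓞 L) (𝓞 M) (2 * j) * α := by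
        intro j hj
        have h1 : a * j ^ 2 ∈ Ideal.span {d ^ 2} := by
          rw [hJ2]
          exact Ideal.mul_mem_mul (Ideal.mem_span_singleton_self _) (Ideal.pow_mem_pow hj 2)
        obtain ⟨k, hk⟩ := Ideal.mem_span_singleton.1 h1
        have hkM := congrArg (algebraMap (𝓞 L) M) hk
        simp only [map_mul, map_pow] at hkM
        have hβ : IsIntegral ℤ (algebraMap (𝓞 L) M j * (α : M) / algebraMap (𝓞 L) M d) := by
          apply isIntegral_quad (L := L) _ 0 k
          change _ = _ + algebraMap (𝓞 L) M k
          rw [div_pow, mul_pow, haM, mul_comm, hkM]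
          field_simp
          simp
        obtain ⟨β, hβv⟩ : ∃ β : 𝓞 M, (β : M) =
          algebraMap (𝓞 L) M j * (α : M) / algebraMap (𝓞 L) M d := ⟨⟨_, hβ⟩, rfl⟩
        refine ⟨-(σ β - β), neg_mem (hDm _), ?_⟩
        apply RingOfIntegers.ext
        change algebraMap (𝓞 L) M d * -(σ₀ (β : M) - (β : M)) = algebraMap (𝓞 L) M (2 * j) * α
        rw [hβv, map_div₀, map_mul, hα]
        have e1 : ∀ x : 𝓞 L, σ₀ (algebraMap (𝓞 L) M x) = algebraMap (𝓞 L) M x := by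
          intro x
          exact σ₀.commutes x
        rw [e1, e1, map_mul, map_ofNat]
        field_simp
        ring
      have b2 : ∀ x ∈ J ^ 2, ∃ y ∈ D, 
          algebraMap (𝓞 L) (𝓞 M) (d ^ 2) * y = algebraMap (𝓞 L) (𝓞 M) (4 * (a * x)) := by
        intro x hx
        rw [sq] at hx
        induction hx using Submodule.mul_induction_on' with
        | mem_mul_mem j hj j' hj' =>
          obtain ⟨w, hw, hw1⟩ := b1 j hj
          obtain ⟨w', hw', hw1'⟩ := b1 j' hj'
          refine ⟨w * w', D.mul_mem_left _ hw', ?_⟩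
          simp only [map_mul, map_pow, map_ofNat] at hw1 hw1' ⊢
          rw [← hαa]
          linear_combination algebraMap (𝓞 L) (𝓞 M) d * w' * hw1 + 
            2 * algebraMap (𝓞 L) (𝓞 M) j * α * hw1'
        | add x hx y hy h1 h2 =>
          obtain ⟨w, hw, hw1⟩ := h1
          obtain ⟨w', hw', hw1'⟩ := h2
          refine ⟨w + w', add_mem hw hw', ?_⟩
          simp only [map_mul, map_pow, map_ofNat, map_add] at hw1 hw1' ⊢
          linear_combination hw1 + hw1'
      have h5 : d ^ 2 ∈ Ideal.span {a} * J ^ 2 := hJ2 ▸ Ideal.mem_span_singleton_self _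
      obtain ⟨x, hx, hxd⟩ := Ideal.mem_span_singleton_mul.1 h5
      obtain ⟨y, hy, hyd⟩ := b2 x hx
      rw [hxd, mul_comm 4, map_mul] at hyd
      have h6 : algebraMap (𝓞 L) (𝓞 M) (d ^ 2) ≠ 0 := by
        rw [Ne, map_eq_zero_iff _ hinj]
        exact pow_ne_zero _ hd0
      have h7 := mul_left_cancel₀ h6 hyd
      rw [h7, map_ofNat] at hy
      exact hy
    rw [Ideal.eq_top_iff_one]
    obtain ⟨u, v, huv⟩ := hc
    have e1 := congrArg (algebraMap (𝓞 L) (𝓞 M)) huv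
    simp only [map_add, map_mul, map_ofNat, map_one] at e1
    set A := algebraMap (𝓞 L) (𝓞 M)
    have e2 : (1 : 𝓞 M) = (A u * A u * A a + 4 * A u * A v) * A a + A v * A v * 4 := by
      linear_combination -(A u * A a + A v * 2 + 1) * e1
    rw [e2]
    exact add_mem (D.mul_mem_left _ d2) (D.mul_mem_left _ d3)
  obtain ⟨h0, h1⟩ := herbrand_units hfr σ hσ hfix
  have hnz : ∀ J : (Ideal (𝓞 M))⁰, Ideal.relNorm (𝓞 L) (J : Ideal (𝓞 M)) ∈ (Ideal (𝓞 L))⁰ := by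
    intro J
    rw [mem_nonZeroDivisors_iff_ne_zero, Ne, Ideal.zero_eq_bot, Ideal.relNorm_eq_bot_iff]
    exact nonZeroDivisors.coe_ne_zero _
  obtain ⟨N, hN⟩ := exists_lift (S := 𝓞 M) (G := ClassGroup (𝓞 L))
    (ClassGroup.mk0.comp ⟨⟨fun J : (Ideal (𝓞 M))⁰ => 
      (⟨Ideal.relNorm (𝓞 L) (J : Ideal (𝓞 M)), hnz J⟩ : (Ideal (𝓞 L))⁰),
      by ext1; exact map_one (Ideal.relNorm (𝓞 L))⟩, by intro J K; ext1; exact map_mul _ _ _⟩) (by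
      intro J x hJ
      simp only [MonoidHom.coe_comp, Function.comp_apply, MonoidHom.coe_mk, OneHom.coe_mk]
      rw [ClassGroup.mk0_eq_one_iff, hJ, Ideal.relNorm_singleton]
      exact ⟨_, rfl⟩)
  have hN' : ∀ (J : (Ideal (𝓞 M))⁰) (K : (Ideal (𝓞 L))⁰), 
      Ideal.relNorm (𝓞 L) (J : Ideal (𝓞 M)) = K → N (ClassGroup.mk0 J) = ClassGroup.mk0 K := by
    intro J K h
    rw [hN]
    simp only [MonoidHom.coe_comp, Function.comp_apply, MonoidHom.coe_mk, OneHom.coe_mk]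
    congr 1
    exact Subtype.ext h
  have hconj : ∀ J : Ideal (𝓞 M), Ideal.relNorm (𝓞 L) (conjI σ J) = Ideal.relNorm (𝓞 L) J := by
    intro J
    exact Ideal.relNorm_map_algEquiv σ J
  have hfr' : Module.finrank (𝓞 L) (𝓞 M) = 2 := by
    rw [← hfr]; exact (IsFractionRing.finrank_eq (𝓞 L) L (𝓞 M) M).symm
  refine ⟨N.range, norm_range_lt hσ hne hfix hD N ?_ h0 h1, ?_, ?_⟩
  · intro J K h
    rw [hN' J ⟨_, hnz J⟩ rfl]
    apply hN'
    rw [h]; exact hconj _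
  · intro c
    obtain ⟨J, rfl⟩ := ClassGroup.mk0_surjective c
    refine ⟨ClassGroup.mk0 (ClassGroup.extendedIdeal (𝓞 L) (𝓞 M) J), ?_⟩
    rw [hN' _ (J ^ 2), map_pow]
    rw [ClassGroup.extendedIdeal, Ideal.relNorm_algebraMap, hfr']
    rfl
  · rintro l hl h2a ⟨x, hx⟩
    set A := algebraMap (𝓞 L) (𝓞 M) with hA
    set P : Ideal (𝓞 M) := (l : Ideal (𝓞 L)).map A ⊔ Ideal.span {A x - α} with hP
    have hl0 : (l : Ideal (𝓞 L)) ≠ ⊥ := nonZeroDivisors.coe_ne_zero _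
    have hσP : conjI σ P = (l : Ideal (𝓞 L)).map A ⊔ Ideal.span {A x + α} := by
      change Ideal.map _ P = _
      rw [hP, Ideal.map_sup, Ideal.map_map, Ideal.map_span, Set.image_singleton]
      congr 1
      · congr 1
        ext y
        simp [hA]
      · congr 2
        simp [hσα, hA]
    have hcop : P ⊔ conjI σ P = ⊤ := by
      have hmax := hl.isMaximal hl0
      have h2x : 2 * x ∉ (l : Ideal (𝓞 L)) := by
        intro h
        rcases hl.mem_or_mem h with h | h
        · exact h2a (Ideal.mul_mem_right _ _ h)
        · apply h2a
          apply Ideal.mul_mem_left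
          have := add_mem hx (Ideal.mul_mem_left _ x h)
          convert this using 1; ring
      obtain ⟨y, hy⟩ := hmax.exists_inv h2x
      obtain ⟨i, hi, hyi⟩ := hy
      rw [Ideal.eq_top_iff_one]
      have e := congrArg A hyi
      simp only [map_add, map_mul, map_ofNat, map_one] at e
      have e' : (1 : 𝓞 M) = (A y * (A x - α) + A i) + A y * (A x + α) := by
        linear_combination -e
      rw [e', hσP]
      refine add_mem (Ideal.mem_sup_left (add_mem ?_ ?_)) (Ideal.mem_sup_right ?_)
      · exact Ideal.mul_mem_left _ _ (Ideal.mem_sup_right (Ideal.mem_span_singleton_self _))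
      · exact Ideal.mem_sup_left (Ideal.mem_map_of_mem _ hi)
      · exact Ideal.mul_mem_left _ _ (Ideal.mem_sup_right (Ideal.mem_span_singleton_self _))
    have hprod : P * conjI σ P = (l : Ideal (𝓞 L)).map A := by
      apply le_antisymm
      · rw [hσP, hP, Ideal.mul_sup, Ideal.sup_mul, Ideal.sup_mul, Ideal.span_singleton_mul_span_singleton]
        refine sup_le (sup_le Ideal.mul_le_right Ideal.mul_le_right) (sup_le Ideal.mul_le_left ?_)
        rw [Ideal.span_singleton_le_iff_mem]
        have := Ideal.mem_map_of_mem A (neg_mem hx)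
        convert this using 1
        simp only [map_neg, map_sub, map_pow]
        rw [← hαa]; ring
      · rw [Ideal.mul_eq_inf_of_coprime hcop, hσP]
        exact le_inf le_sup_left le_sup_left
    have hrel : Ideal.relNorm (𝓞 L) P = l := by
      apply ideal_sq_inj
      have := congrArg (Ideal.relNorm (𝓞 L)) hprod
      rw [map_mul, hconj, Ideal.relNorm_algebraMap, hfr'] at this
      rw [sq, this]
    have hP0 : P ∈ (Ideal (𝓞 M))⁰ := by
      rw [mem_nonZeroDivisors_iff_ne_zero]
      intro h
      rw [h] at hrel
      apply hl0
      rw [← hrel, Ideal.zero_eq_bot, Ideal.relNorm_bot]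
    exact ⟨ClassGroup.mk0 ⟨P, hP0⟩, hN' ⟨P, hP0⟩ l hrel⟩

end main
end TwoRank

namespace TwoRank
open scoped nonZeroDivisors

theorem main_lemma {L : Type*} [Field L] [NumberField L] [IsTotallyComplex L] (a s : 𝓞 L)
    (hns : ∀ γ : L, γ ^ 2 ≠ a) (h4 : 4 ∣ a - s ^ 2)
    (I : Ideal (𝓞 L)) (hI : Ideal.span {a} = I ^ 2) (hc : IsCoprime a 2) :
    ∃ H : Subgroup (ClassGroup (𝓞 L)), H ≠ ⊤ ∧ (∀ c, c ^ 2 ∈ H) ∧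
      ∀ l : (Ideal (𝓞 L))⁰, (l : Ideal (𝓞 L)).IsPrime → 2 * a ∉ (l : Ideal (𝓞 L)) →
        (∃ x, a - x ^ 2 ∈ (l : Ideal (𝓞 L))) → ClassGroup.mk0 l ∈ H := by
  set f : Polynomial L := Polynomial.X ^ 2 - Polynomial.C (a : L) with hf
  have hirr : Irreducible f := X_pow_sub_C_irreducible_of_prime Nat.prime_two hns
  have hfact : Fact (Irreducible f) := ⟨hirr⟩
  have hmon : f.Monic := Polynomial.monic_X_pow_sub_C _ two_ne_zero
  have hfin : Module.Finite L (AdjoinRoot f) := hmon.finite_adjoinRoot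
  have : CharZero (AdjoinRoot f) := charZero_of_injective_algebraMap (algebraMap L (AdjoinRoot f)).injective
  have hnf : NumberField (AdjoinRoot f) := NumberField.of_module_finite L (AdjoinRoot f)
  have hdeg : f.natDegree = 2 := Polynomial.natDegree_X_pow_sub_C
  have hfr : Module.finrank L (AdjoinRoot f) = 2 := by
    rw [← hdeg, (AdjoinRoot.powerBasis hirr.ne_zero).finrank, AdjoinRoot.powerBasis_dim]
  have hroot : AdjoinRoot.root f ^ 2 = algebraMap L (AdjoinRoot f) a := by
    have := AdjoinRoot.eval₂_root f
    simp only [hf, Polynomial.eval₂_sub, Polynomial.eval₂_pow, Polynomial.eval₂_X,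
      Polynomial.eval₂_C] at this
    exact sub_eq_zero.1 this
  obtain ⟨α, hα⟩ : ∃ α : 𝓞 (AdjoinRoot f), (α : AdjoinRoot f) = AdjoinRoot.root f := by
    have hInt : IsIntegral ℤ (AdjoinRoot.root f) := by
      apply isIntegral_quad (L := L) _ 0 a
      rw [hroot]; simp
    exact ⟨⟨_, hInt⟩, rfl⟩
  let φ : AdjoinRoot f →ₐ[L] AdjoinRoot f :=
    AdjoinRoot.liftAlgHom f (Algebra.ofId L _) (-AdjoinRoot.root f) (by
      simp only [hf, Polynomial.eval₂_sub, Polynomial.eval₂_pow, Polynomial.eval₂_X,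
        Polynomial.eval₂_C, neg_sq, hroot]
      exact sub_self _)
  have hφ : φ (AdjoinRoot.root f) = -AdjoinRoot.root f := by
    simp [φ]
  let σ₀ : AdjoinRoot f ≃ₐ[L] AdjoinRoot f := AlgEquiv.ofAlgHom φ φ
    (by ext; simp [hφ]) (by ext; simp [hφ])
  refine main_abs hfr σ₀ α ?_ ?_ a s ?_ ?_ h4 I hI hc
  · rw [hα]; exact hφ
  · intro m
    induction m using AdjoinRoot.induction_on with
    | ih q =>
      have h1 : (q %ₘ f).natDegree ≤ 1 := by
        have := Polynomial.natDegree_modByMonic_lt q hmon (by intro h; rw [h] at hdeg; simp at hdeg)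
        omega
      obtain ⟨y, x, hxy⟩ := Polynomial.exists_eq_X_add_C_of_natDegree_le_one h1
      refine ⟨x, y, ?_⟩
      have h2 := Polynomial.modByMonic_add_div q f
      rw [← h2, map_add, map_mul, AdjoinRoot.mk_self, zero_mul, add_zero, hxy, map_add, map_mul, hα,
        add_comm]
      rfl
  · apply RingOfIntegers.ext
    change (α : AdjoinRoot f) ^ 2 = _
    rw [hα, hroot]
    rfl
  · rintro rfl
    exact hns 0 (by simp)

theorem isSquare_mul_of_not {F : Type*} [Field F] [Fintype F] {x y : F} (hx : ¬ IsSquare x)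
    (hy : ¬ IsSquare y) : IsSquare (x * y) := by
  classical
  have hx0 : x ≠ 0 := by rintro rfl; exact hx IsSquare.zero
  have hy0 : y ≠ 0 := by rintro rfl; exact hy IsSquare.zero
  rw [← quadraticChar_one_iff_isSquare (mul_ne_zero hx0 hy0), map_mul,
    quadraticChar_neg_one_iff_not_isSquare.2 hx, quadraticChar_neg_one_iff_not_isSquare.2 hy]
  norm_num

/-- Group theory and Chebotarev-free conclusion. -/
theorem four_le_of {L : Type*} [Field L] [NumberField L] [IsTotallyComplex L] (a b s t : 𝓞 L)
    (hna : ∀ γ : L, γ ^ 2 ≠ a) (hnb : ∀ γ : L, γ ^ 2 ≠ b) (hnab : ∀ γ : L, γ ^ 2 ≠ a * b)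
    (ha4 : 4 ∣ a - s ^ 2) (hb4 : 4 ∣ b - t ^ 2)
    (I J : Ideal (𝓞 L)) (hI : Ideal.span {a} = I ^ 2) (hJ : Ideal.span {b} = J ^ 2)
    (hca : IsCoprime a 2) (hcb : IsCoprime b 2) :
    4 ≤ Nat.card (ClassGroup (𝓞 L) ⧸ (powMonoidHom 2 : ClassGroup (𝓞 L) →* ClassGroup (𝓞 L)).range) := by
  obtain ⟨H1, h1, h1', h1''⟩ := main_lemma a s hna ha4 I hI hca
  obtain ⟨H2, h2, h2', h2''⟩ := main_lemma b t hnb hb4 J hJ hcb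
  obtain ⟨H3, h3, h3', h3''⟩ := main_lemma (a * b) (s * t) (by simpa using hnab)
    (by
      have := dvd_add (ha4.mul_right b) (hb4.mul_left (s ^ 2))
      convert this using 1; ring)
    (I * J) (by rw [mul_pow, ← hI, ← hJ, Ideal.span_singleton_mul_span_singleton])
    (IsCoprime.mul_left hca hcb)
  have ha0 : a ≠ 0 := by
    rintro rfl
    exact hna 0 (by simp)
  have hb0 : b ≠ 0 := by
    rintro rfl
    exact hnb 0 (by simp)
  -- every prime not containing 2ab is in H1 ∪ H2 ∪ H3
  have hpr : ∀ l : (Ideal (𝓞 L))⁰, (l : Ideal (𝓞 L)).IsPrime → 2 * (a * b) ∉ (l : Ideal (𝓞 L)) →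
      ClassGroup.mk0 l ∈ H1 ∨ ClassGroup.mk0 l ∈ H2 ∨ ClassGroup.mk0 l ∈ H3 := by
    intro l hl hab
    have hl0 : (l : Ideal (𝓞 L)) ≠ ⊥ := nonZeroDivisors.coe_ne_zero _
    have hmax := hl.isMaximal hl0
    let F := 𝓞 L ⧸ (l : Ideal (𝓞 L))
    let _ : Field F := Ideal.Quotient.field _
    have : Finite F := Ideal.finiteQuotientOfFreeOfNeBot _ hl0
    let _ : Fintype F := Fintype.ofFinite F
    have sq : ∀ c : 𝓞 L, IsSquare (Ideal.Quotient.mk (l : Ideal (𝓞 L)) c) →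
        ∃ x, c - x ^ 2 ∈ (l : Ideal (𝓞 L)) := by
      rintro c ⟨y, hy⟩
      obtain ⟨x, rfl⟩ := Ideal.Quotient.mk_surjective y
      refine ⟨x, ?_⟩
      rw [← Ideal.Quotient.eq_zero_iff_mem, map_sub, map_pow, hy, _root_.sq, sub_self]
    by_cases hsa : IsSquare (Ideal.Quotient.mk (l : Ideal (𝓞 L)) a)
    · left
      refine h1'' l hl (fun h => hab ?_) (sq _ hsa)
      rw [← mul_assoc]; exact Ideal.mul_mem_right _ _ h
    by_cases hsb : IsSquare (Ideal.Quotient.mk (l : Ideal (𝓞 L)) b)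
    · right; left
      refine h2'' l hl (fun h => hab ?_) (sq _ hsb)
      rw [mul_left_comm]; exact Ideal.mul_mem_left _ _ h
    · right; right
      refine h3'' l hl hab (sq _ ?_)
      rw [map_mul]
      exact isSquare_mul_of_not hsa hsb
  set Q := (powMonoidHom 2 : ClassGroup (𝓞 L) →* ClassGroup (𝓞 L)).range with hQ
  by_contra hlt
  change ¬ 4 ≤ Q.index at hlt
  have hQH : ∀ H : Subgroup (ClassGroup (𝓞 L)), H ≠ ⊤ → (∀ c, c ^ 2 ∈ H) → H ≤ Q := by
    intro H hH hsq
    have hle : Q ≤ H := by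
      rintro _ ⟨c, rfl⟩
      exact hsq c
    have e := Subgroup.relIndex_mul_index hle
    have i1 : H.index ≠ 1 := by rwa [Ne, Subgroup.index_eq_one]
    have i0 : H.index ≠ 0 := Subgroup.index_ne_zero_of_finite
    have i3 : Q.index ≠ 0 := Subgroup.index_ne_zero_of_finite
    rw [← Subgroup.relIndex_eq_one]
    have j2 : 2 ≤ H.index := by omega
    have j0 : Q.relIndex H ≠ 0 := by
      intro h
      rw [h, zero_mul] at e
      exact i3 e.symm
    by_contra hne
    have : 2 ≤ Q.relIndex H := by omega
    have := Nat.mul_le_mul this j2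
    omega
  have hpQ : ∀ l : (Ideal (𝓞 L))⁰, (l : Ideal (𝓞 L)).IsPrime → 2 * (a * b) ∉ (l : Ideal (𝓞 L)) →
      ClassGroup.mk0 l ∈ Q := by
    intro l hl hab
    rcases hpr l hl hab with h | h | h
    · exact hQH H1 h1 h1' h
    · exact hQH H2 h2 h2' h
    · exact hQH H3 h3 h3' h
  have hm0 : 2 * (a * b) ≠ 0 := mul_ne_zero two_ne_zero (mul_ne_zero ha0 hb0)
  generalize 2 * (a * b) = m at hpQ hm0
  have hgen : ∀ K : Ideal (𝓞 L), ∀ hK : K ≠ 0, K ⊔ Ideal.span {m} = ⊤ →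
      ClassGroup.mk0 ⟨K, mem_nonZeroDivisors_of_ne_zero hK⟩ ∈ Q := by
    intro K
    induction K using UniqueFactorizationMonoid.induction_on_prime with
    | h₁ => exact fun h => absurd rfl h
    | h₂ x hx =>
      intro h _
      have : ClassGroup.mk0 ⟨x, mem_nonZeroDivisors_of_ne_zero h⟩ = 1 := by
        rw [ClassGroup.mk0_eq_one_iff]
        change Submodule.IsPrincipal x
        rw [Ideal.isUnit_iff.1 hx]
        infer_instance
      rw [this]
      exact one_mem _
    | h₃ K l hK hl ih =>
      intro h hcop
      have e : (⟨l * K, mem_nonZeroDivisors_of_ne_zero h⟩ : (Ideal (𝓞 L))⁰) = 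
        ⟨l, mem_nonZeroDivisors_of_ne_zero hl.ne_zero⟩ * ⟨K, mem_nonZeroDivisors_of_ne_zero hK⟩ := rfl
      rw [e, map_mul]
      refine mul_mem (hpQ _ (Ideal.isPrime_of_prime hl) ?_) (ih hK ?_)
      · intro hm
        apply (Ideal.isPrime_of_prime hl).ne_top
        rw [eq_top_iff, ← hcop]
        exact sup_le Ideal.mul_le_left ((Ideal.span_singleton_le_iff_mem _).2 hm)
      · rw [eq_top_iff, ← hcop]
        exact sup_le_sup_right Ideal.mul_le_right _
  apply h1
  rw [eq_top_iff]
  intro c _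
  suffices hc : c ∈ Q by
    obtain ⟨d, rfl⟩ := hc
    exact h1' d
  obtain ⟨K, hK⟩ := ClassGroup.mk0_surjective c⁻¹
  have hK0 : (K : Ideal (𝓞 L)) ≠ ⊥ := nonZeroDivisors.coe_ne_zero _
  have hKm : (K : Ideal (𝓞 L)) * Ideal.span {m} ≠ 0 := 
    mul_ne_zero hK0 (by simpa using hm0)
  obtain ⟨y, hy0, hy⟩ : ∃ y, y ≠ 0 ∧ (K : Ideal (𝓞 L)) * Ideal.span {m} ⊔ Ideal.span {y} = K := by
    obtain ⟨y, hy⟩ := IsDedekindDomain.exists_sup_span_eq (I := (K : Ideal (𝓞 L)) * Ideal.span {m})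
      (J := K) Ideal.mul_le_left hKm
    by_cases hy0 : y = 0
    · rw [hy0] at hy
      simp only [Ideal.span_singleton_zero, Submodule.bot_coe, bot_le, sup_of_le_left] at hy
      obtain ⟨d, hd, hd0⟩ := Submodule.exists_mem_ne_zero_of_ne_bot hK0
      refine ⟨d, hd0, ?_⟩
      rw [hy, sup_eq_left]
      exact (Ideal.span_singleton_le_iff_mem _).2 hd
    · exact ⟨y, hy0, hy⟩
  have hyK : y ∈ (K : Ideal (𝓞 L)) := by
    rw [← hy]
    exact Ideal.mem_sup_right (Ideal.mem_span_singleton_self _)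
  obtain ⟨K', hK'⟩ := Ideal.dvd_span_singleton.2 hyK
  have hK'0 : K' ≠ 0 := by
    rintro rfl
    rw [mul_zero] at hK'
    exact hy0 (by simpa using hK')
  have hcop : K' ⊔ Ideal.span {m} = ⊤ := by
    rw [hK', ← Ideal.mul_sup] at hy
    have : (K : Ideal (𝓞 L)) * (Ideal.span {m} ⊔ K') = K * 1 := by rw [hy, mul_one]
    rw [sup_comm]
    exact mul_left_cancel₀ hK0 (this.trans (by rw [Ideal.one_eq_top]))
  have := hgen K' hK'0 hcop
  convert this using 1
  have e : ClassGroup.mk0 (K * ⟨K', mem_nonZeroDivisors_of_ne_zero hK'0⟩) = 1 := by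
    rw [ClassGroup.mk0_eq_one_iff]
    change Submodule.IsPrincipal ((K : Ideal (𝓞 L)) * K')
    rw [← hK']
    exact ⟨_, rfl⟩
  rw [map_mul, hK, inv_mul_eq_one] at e
  exact e

theorem not_cyclic_of {A : Type*} [CommGroup A] [Finite A]
    (h : 4 ≤ Nat.card (A ⧸ (powMonoidHom 2 : A →* A).range)) :
    ¬ IsCyclic (CommGroup.primaryComponent A 2) := by
  intro hcyc
  obtain ⟨k, m, hm, hkm⟩ := Nat.exists_eq_two_pow_mul_odd (n := Nat.card A) Nat.card_pos.ne'
  obtain ⟨g, hg⟩ := hcyc.exists_generator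
  set Q := (powMonoidHom 2 : A →* A).range with hQ
  have h1 : ∀ x : A, ∃ n : ℤ, (QuotientGroup.mk x : A ⧸ Q) = (QuotientGroup.mk (g : A)) ^ n := by
    intro x
    have hx : x ^ m ∈ CommGroup.primaryComponent A 2 := by
      refine ⟨k, ?_⟩
      rw [← pow_mul, mul_comm, ← hkm, pow_card_eq_one']
    obtain ⟨n, hn⟩ := hg ⟨x ^ m, hx⟩
    obtain ⟨j, hj⟩ := hm
    refine ⟨n, ?_⟩
    rw [← QuotientGroup.mk_zpow]
    have hn' : (g : A) ^ n = x ^ m := congrArg Subtype.val hn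
    rw [hn', QuotientGroup.eq]
    refine ⟨x ^ j, ?_⟩
    rw [hj, powMonoidHom_apply]
    group
  have h2 : (QuotientGroup.mk (g : A) : A ⧸ Q) ^ 2 = 1 := by
    rw [← QuotientGroup.mk_pow, QuotientGroup.eq_one_iff]
    exact ⟨g, rfl⟩
  have h3 : Nat.card (A ⧸ Q) ≤ Nat.card (Fin 2) := by
    refine Nat.card_le_card_of_surjective 
      (fun i : Fin 2 => (QuotientGroup.mk (g : A) : A ⧸ Q) ^ (i : ℕ)) ?_
    intro y
    obtain ⟨x, rfl⟩ := QuotientGroup.mk_surjective y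
    obtain ⟨n, hn⟩ := h1 x
    rcases Int.even_or_odd' n with ⟨q, rfl | rfl⟩
    · refine ⟨0, ?_⟩
      rw [hn, zpow_mul]
      simp [h2]
    · refine ⟨1, ?_⟩
      rw [hn, zpow_add, zpow_mul]
      simp [h2]
  simp at h3
  omega
end TwoRank

namespace TwoRank
open scoped nonZeroDivisors

/-- evaluation of `a0 + a1 c1 + a2 c2 + a3 c3` at `θ = t`. -/
def evQ {S : Type*} [CommRing S] (a0 a1 a2 a3 t : S) : S :=
  a0 + a1 * t + a2 * (t ^ 2 - 2) + a3 * (t ^ 3 - 3 * t)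

/-- first component of the relative norm -/
def nA {S : Type*} [CommRing S] (a0 a1 a2 a3 : S) : S := a0^2 + 2*a2^2 - 2*a1^2 - 2*a3^2
/-- second component of the relative norm -/
def nB {S : Type*} [CommRing S] (a0 a1 a2 a3 : S) : S := 2*a0*a2 - a1^2 - 2*a1*a3 + a3^2
/-- the norm form of `ℤ[θ]` -/
def nQ {S : Type*} [CommRing S] (a0 a1 a2 a3 : S) : S := nA a0 a1 a2 a3 ^ 2 - 2 * nB a0 a1 a2 a3 ^ 2

theorem root_conj {S : Type*} [CommRing S] {t : S} (ht : t ^ 4 - 4 * t ^ 2 + 2 = 0) :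
    (t ^ 3 - 3 * t) ^ 4 - 4 * (t ^ 3 - 3 * t) ^ 2 + 2 = 0 := by
  have h2 : (t ^ 3 - 3 * t) ^ 2 = 4 - t ^ 2 := by
    linear_combination (t ^ 2 - 2) * ht
  linear_combination ((t ^ 3 - 3 * t) ^ 2 - t ^ 2) * h2 + ht

theorem root_neg {S : Type*} [CommRing S] {t : S} (ht : t ^ 4 - 4 * t ^ 2 + 2 = 0) :
    (-t) ^ 4 - 4 * (-t) ^ 2 + 2 = 0 := by
  linear_combination ht

theorem root_conj_conj {S : Type*} [CommRing S] {t : S} (ht : t ^ 4 - 4 * t ^ 2 + 2 = 0) :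
    (t ^ 3 - 3 * t) ^ 3 - 3 * (t ^ 3 - 3 * t) = -t := by
  have h2 : (t ^ 3 - 3 * t) ^ 2 = 4 - t ^ 2 := by
    linear_combination (t ^ 2 - 2) * ht
  linear_combination (t ^ 3 - 3 * t) * h2 - t * ht

theorem evQ_mul_neg {S : Type*} [CommRing S] (a0 a1 a2 a3 : S) {t : S}
    (ht : t ^ 4 - 4 * t ^ 2 + 2 = 0) :
    evQ a0 a1 a2 a3 t * evQ a0 a1 a2 a3 (-t) = nA a0 a1 a2 a3 + nB a0 a1 a2 a3 * (t ^ 2 - 2) := by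
  simp only [evQ, nA, nB]
  linear_combination (a2 ^ 2 - 2 * a1 * a3 - (t ^ 2 - 2) * a3 ^ 2) * ht

theorem evQ_prod {S : Type*} [CommRing S] (a0 a1 a2 a3 : S) {t : S}
    (ht : t ^ 4 - 4 * t ^ 2 + 2 = 0) :
    evQ a0 a1 a2 a3 t * (evQ a0 a1 a2 a3 (t ^ 3 - 3 * t) * (evQ a0 a1 a2 a3 (-t) *
      evQ a0 a1 a2 a3 (-(t ^ 3 - 3 * t)))) = nQ a0 a1 a2 a3 := by
  have h1 := evQ_mul_neg a0 a1 a2 a3 ht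
  have h2 := evQ_mul_neg a0 a1 a2 a3 (root_conj ht)
  have h3 : (t ^ 3 - 3 * t) ^ 2 = 4 - t ^ 2 := by
    linear_combination (t ^ 2 - 2) * ht
  have : evQ a0 a1 a2 a3 t * (evQ a0 a1 a2 a3 (t ^ 3 - 3 * t) * (evQ a0 a1 a2 a3 (-t) *
      evQ a0 a1 a2 a3 (-(t ^ 3 - 3 * t)))) = (evQ a0 a1 a2 a3 t * evQ a0 a1 a2 a3 (-t)) *
      (evQ a0 a1 a2 a3 (t ^ 3 - 3 * t) * evQ a0 a1 a2 a3 (-(t ^ 3 - 3 * t))) := by ring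
  rw [this, h1, h2, h3, nQ]
  set A := nA a0 a1 a2 a3
  set B := nB a0 a1 a2 a3
  linear_combination (-B ^ 2) * ht

theorem int_sqrt2 (x y : ℤ) (h : x ^ 2 = 2 * y ^ 2) : x = 0 ∧ y = 0 := by
  by_cases hy : y = 0
  · subst hy; simpa using h
  · exfalso
    have h2 : Irrational (√2) := irrational_sqrt_two
    have h3 : (x / y : ℝ) ^ 2 = 2 := by
      have : (x : ℝ) ^ 2 = 2 * (y : ℝ) ^ 2 := by exact_mod_cast h
      have hy' : (y : ℝ) ≠ 0 := by exact_mod_cast hy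
      field_simp
      exact this.trans (mul_comm _ _)
    have h4 : √2 = |(x / y : ℝ)| := by
      rw [← h3, Real.sqrt_sq_eq_abs]
    apply h2
    refine ⟨|(x / y : ℚ)|, ?_⟩
    rw [h4]; push_cast; rfl

theorem nQ_ne_zero (a0 a1 a2 a3 : ℤ) (h : nQ a0 a1 a2 a3 = 0) :
    a0 = 0 ∧ a1 = 0 ∧ a2 = 0 ∧ a3 = 0 := by
  obtain ⟨hA, hB⟩ := int_sqrt2 (nA a0 a1 a2 a3) (nB a0 a1 a2 a3) (by rw [nQ] at h; linarith)
  rw [nA] at hA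
  rw [nB] at hB
  obtain ⟨h1, h2⟩ := int_sqrt2 (a0 ^ 2 - 2 * a2 ^ 2) (a1 ^ 2 - 2 * a1 * a3 - a3 ^ 2) (by
    linear_combination (a0 ^ 2 + 2 * a2 ^ 2 + 2 * a1 ^ 2 + 2 * a3 ^ 2) * hA
      - 2 * (2 * a0 * a2 + (a1 ^ 2 + 2 * a1 * a3 - a3 ^ 2)) * hB)
  obtain ⟨h3, h4⟩ := int_sqrt2 a0 a2 (by linarith)
  obtain ⟨h5, h6⟩ := int_sqrt2 (a1 - a3) a3 (by linarith)
  exact ⟨h3, by omega, h4, h6⟩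

theorem nQ_le (a0 a1 a2 a3 : ℤ) :
    |nQ a0 a1 a2 a3| ≤ (a0 ^ 2 + 2 * a1 ^ 2 + 2 * a2 ^ 2 + 2 * a3 ^ 2) ^ 2 := by
  have k1 : (2 * a0 * a2) ^ 2 * 2 ≤ (a0 ^ 2 + 2 * a2 ^ 2) ^ 2 := by
    nlinarith [sq_nonneg (a0 ^ 2 - 2 * a2 ^ 2)]
  have k2 : (a1 ^ 2 + 2 * a1 * a3 - a3 ^ 2) ^ 2 ≤ 2 * (a1 ^ 2 + a3 ^ 2) ^ 2 := by
    nlinarith [sq_nonneg (a1 ^ 2 - 2 * a1 * a3 - a3 ^ 2)]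
  have k3 := sq_nonneg (2 * a0 * a2 + (a1 ^ 2 + 2 * a1 * a3 - a3 ^ 2))
  have k4 : 0 ≤ (a0 ^ 2 + 2 * a2 ^ 2) * (2 * a1 ^ 2 + 2 * a3 ^ 2) := by positivity
  rw [abs_le, nQ, nA, nB]
  constructor
  · nlinarith
  · nlinarith [sq_nonneg (2 * a0 * a2 - a1 ^ 2 - 2 * a1 * a3 + a3 ^ 2)]

theorem nQ_odd (a0 a1 a2 a3 : ℤ) (h : a0 % 2 = 1) :
    nQ a0 a1 a2 a3 % 16 = 1 ∨ nQ a0 a1 a2 a3 % 16 = 15 := by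
  obtain ⟨x0, rfl⟩ : ∃ x, a0 = 2 * x + 1 := ⟨a0 / 2, by omega⟩
  obtain ⟨x1, e1, rfl, h1⟩ : ∃ x e, a1 = 2 * x + e ∧ (e = 0 ∨ e = 1) := ⟨a1 / 2, a1 % 2, by omega, by omega⟩
  obtain ⟨x2, e2, rfl, h2⟩ : ∃ x e, a2 = 2 * x + e ∧ (e = 0 ∨ e = 1) := ⟨a2 / 2, a2 % 2, by omega, by omega⟩
  obtain ⟨x3, e3, rfl, h3⟩ : ∃ x e, a3 = 2 * x + e ∧ (e = 0 ∨ e = 1) := ⟨a3 / 2, a3 % 2, by omega, by omega⟩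
  obtain ⟨m, hm⟩ := Int.even_mul_succ_self x0
  obtain ⟨α, hα⟩ : ∃ α, nA (2 * x0 + 1) (2 * x1 + e1) (2 * x2 + e2) (2 * x3 + e3) = 
      8 * α + (1 + 2 * e2 ^ 2 - 2 * e1 ^ 2 - 2 * e3 ^ 2) :=
    ⟨m + x2 ^ 2 + x2 * e2 - x1 ^ 2 - x1 * e1 - x3 ^ 2 - x3 * e3, by
      rw [nA]; linear_combination 4 * hm⟩
  obtain ⟨β, hβ⟩ : ∃ β, nB (2 * x0 + 1) (2 * x1 + e1) (2 * x2 + e2) (2 * x3 + e3) = 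
      4 * β + (2 * e2 - e1 ^ 2 - 2 * e1 * e3 + e3 ^ 2) :=
    ⟨2 * x0 * x2 + x0 * e2 + x2 - x1 ^ 2 - x1 * e1 - 2 * x1 * x3 - x1 * e3 - x3 * e1 + x3 ^ 2 + x3 * e3, by
      rw [nB]; ring⟩
  rw [nQ, hα, hβ]
  clear hα hβ hm
  rcases h1 with rfl | rfl <;> rcases h2 with rfl | rfl <;> rcases h3 with rfl | rfl <;> norm_num <;>
    ring_nf <;> omega

theorem nQ_even (a0 a1 a2 a3 : ℤ) (h : a0 % 2 = 0) :
    ∃ b0 b1 b2 b3, nQ a0 a1 a2 a3 = 2 * nQ b0 b1 b2 b3 := by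
  obtain ⟨x0, rfl⟩ : ∃ x, a0 = 2 * x := ⟨a0 / 2, by omega⟩
  refine ⟨a1 - a3, x0, a3, a2 - x0, ?_⟩
  simp only [nQ, nA, nB]
  ring

theorem nQ_descent (p : ℤ) (hp : p % 16 = 15) : ∀ (k : ℕ) (c a0 a1 a2 a3 : ℤ), c.natAbs = k →
    k < 10 → c ≠ 0 → nQ a0 a1 a2 a3 = c * p → ∃ b0 b1 b2 b3 : ℤ, 
      (nQ b0 b1 b2 b3 = p ∨ nQ b0 b1 b2 b3 = -p) := by
  intro k
  induction k using Nat.strong_induction_on with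
  | _ k ih =>
    intro c a0 a1 a2 a3 hck hk hc h
    rcases Int.emod_two_eq_zero_or_one a0 with h0 | h0
    · obtain ⟨b0, b1, b2, b3, hb⟩ := nQ_even a0 a1 a2 a3 h0
      rw [hb] at h
      have hev : c % 2 = 0 := by
        have : (c * p) % 2 = 0 := by rw [← h]; omega
        rw [Int.mul_emod] at this
        have hp2 : p % 2 = 1 := by omega
        rw [hp2] at this
        omega
      obtain ⟨d, rfl⟩ : ∃ d, c = 2 * d := ⟨c / 2, by omega⟩
      refine ih d.natAbs (by omega) d b0 b1 b2 b3 rfl (by omega) (by omega) ?_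
      have : 2 * nQ b0 b1 b2 b3 = 2 * (d * p) := by rw [h]; ring
      omega
    · have := nQ_odd a0 a1 a2 a3 h0
      rw [h, Int.mul_emod, hp] at this
      have hc1 : c = 1 ∨ c = -1 := by
        have : -10 < c ∧ c < 10 := by omega
        obtain ⟨l, u⟩ := this
        interval_cases c <;> simp_all
      refine ⟨a0, a1, a2, a3, ?_⟩
      rcases hc1 with rfl | rfl
      · left; rw [h]; ring
      · right; rw [h]; ring

end TwoRank

namespace TwoRank
open scoped nonZeroDivisors

theorem theta_root {F : Type*} [Field F] {z : F} (hz : z ^ 8 = -1) :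
    (z + z⁻¹) ^ 4 - 4 * (z + z⁻¹) ^ 2 + 2 = 0 := by
  have hz0 : z ≠ 0 := by rintro rfl; norm_num at hz
  have h : z * z⁻¹ = 1 := mul_inv_cancel₀ hz0
  have h1 : (z + z⁻¹) ^ 4 - 4 * (z + z⁻¹) ^ 2 + 2 = z ^ 4 + z⁻¹ ^ 4 := by
    linear_combination (4 * z ^ 2 + 4 * z⁻¹ ^ 2 + 6 * z * z⁻¹ - 2) * h
  have h2 : z⁻¹ ^ 4 = - z ^ 4 := by
    have : (z * z⁻¹) ^ 4 = 1 := by rw [h, one_pow]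
    linear_combination z⁻¹ ^ 4 * hz - z ^ 4 * this
  rw [h1, h2]; ring

theorem exists_root_zmod (p : ℕ) [Fact p.Prime] (hp16 : p % 16 = 15) :
    ∃ r : ZMod p, r ^ 4 - 4 * r ^ 2 + 2 = 0 := by
  let K := AlgebraicClosure (ZMod p)
  have : CharP K p := charP_of_injective_algebraMap (algebraMap (ZMod p) K).injective p
  obtain ⟨z, hz⟩ : ∃ z : K, z ^ 8 = -1 := IsAlgClosed.exists_pow_nat_eq (-1 : K) (by norm_num)
  have hz0 : z ≠ 0 := by rintro rfl; norm_num at hz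
  have hz16 : z ^ 16 = 1 := by
    have : z ^ 16 = (z ^ 8) ^ 2 := by ring
    rw [this, hz]; norm_num
  have hzp : z ^ p = z⁻¹ := by
    apply eq_inv_of_mul_eq_one_left
    rw [← pow_succ]
    obtain ⟨k, hk⟩ : ∃ k, p + 1 = 16 * k := ⟨(p + 1) / 16, by omega⟩
    rw [hk, pow_mul, hz16, one_pow]
  have hθ : (z + z⁻¹) ^ p = z + z⁻¹ := by
    rw [add_pow_char, inv_pow, hzp, inv_inv, add_comm]
  have hmem : z + z⁻¹ ∈ (⊥ : Subfield K) := (Subfield.mem_bot_iff_pow_eq_self K p).2 hθ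
  rw [← ZMod.fieldRange_castHom_eq_bot p] at hmem
  obtain ⟨r, hr⟩ := hmem
  refine ⟨r, (ZMod.castHom (m := p) dvd_rfl K).injective ?_⟩
  have : (ZMod.castHom (m := p) dvd_rfl K) r = z + z⁻¹ := hr
  simp only [map_add, map_sub, map_mul, map_pow, this, map_ofNat, map_zero]
  exact theta_root hz

theorem exists_root_padic (p : ℕ) [Fact p.Prime] (hp16 : p % 16 = 15) :
    ∃ R : ℤ_[p], R ^ 4 - 4 * R ^ 2 + 2 = 0 := by
  obtain ⟨r, hr⟩ := exists_root_zmod p hp16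
  obtain ⟨m, rfl⟩ := ZMod.intCast_surjective r
  have hpp : p.Prime := Fact.out
  let F : Polynomial ℤ_[p] := .X ^ 4 - 4 * .X ^ 2 + 2
  have h2 : (2 : ZMod p) ≠ 0 := by
    intro h
    have := (ZMod.natCast_eq_zero_iff 2 p).1 (by exact_mod_cast h)
    have := Nat.le_of_dvd (by norm_num) this
    have := hpp.two_le
    have : p = 2 := by omega
    omega
  have hd : ∀ k : ℤ, (k : ZMod p) ≠ 0 → ‖(k : ℤ_[p])‖ = 1 := by
    intro k hk
    refine le_antisymm (PadicInt.norm_le_one _) (not_lt.1 fun h => hk ?_)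
    rw [PadicInt.norm_int_lt_one_iff_dvd] at h
    exact (ZMod.intCast_zmod_eq_zero_iff_dvd k p).2 h
  have e1 : F.aeval (m : ℤ_[p]) = ((m ^ 4 - 4 * m ^ 2 + 2 : ℤ) : ℤ_[p]) := by
    simp [F]
  have e2 : F.derivative.aeval (m : ℤ_[p]) = ((4 * m ^ 3 - 8 * m : ℤ) : ℤ_[p]) := by
    simp [F]; ring
  have n1 : ‖F.aeval (m : ℤ_[p])‖ < 1 := by
    rw [e1, PadicInt.norm_int_lt_one_iff_dvd, ← ZMod.intCast_zmod_eq_zero_iff_dvd]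
    push_cast; exact hr
  have n2 : ‖F.derivative.aeval (m : ℤ_[p])‖ = 1 := by
    rw [e2]
    apply hd
    push_cast
    intro h
    have k : (4 : ZMod p) * 2 = 0 := by
      linear_combination (-4 * (m : ZMod p) ^2 + 4) * hr + ((m : ZMod p) ^ 2 - 3) * m * h
    have : (2 : ZMod p) ^ 3 = 0 := by linear_combination k
    exact h2 (pow_eq_zero_iff (by norm_num) |>.1 this)
  obtain ⟨R, hR, -⟩ := hensels_lemma (F := F) (a := (m : ℤ_[p])) (by rw [n2]; simpa using n1)
  exact ⟨R, by simpa [F] using hR⟩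

end TwoRank

namespace TwoRank
open scoped nonZeroDivisors

open MeasureTheory in
theorem minkowski_four (p r1 r2 r3 : ℤ) (hp : 0 < p) : ∃ a0 a1 a2 a3 : ℤ,
    ¬ (a0 = 0 ∧ a1 = 0 ∧ a2 = 0 ∧ a3 = 0) ∧ p ∣ a0 + a1 * r1 + a2 * r2 + a3 * r3 ∧
    (a0 ^ 2 + 2 * a1 ^ 2 + 2 * a2 ^ 2 + 2 * a3 ^ 2) ^ 2 < 10 * p := by
  have hpR : (0 : ℝ) < p := by exact_mod_cast hp
  have hs : (√2 : ℝ) ^ 2 = 2 := Real.sq_sqrt (by norm_num)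
  have hs0 : (0 : ℝ) < √2 := by positivity
  let M : Matrix (Fin 4) (Fin 4) ℝ := !![(p : ℝ), 0, 0, 0; -r1, √2, 0, 0; -r2, 0, √2, 0; -r3, 0, 0, √2]
  have hdet : M.det = p * √2 ^ 3 := by
    simp [M, Matrix.det_succ_row_zero, Fin.sum_univ_succ, Fin.succAbove]
    left
    linear_combination (-√2) * hs
  have hdet0 : M.det ≠ 0 := by rw [hdet]; positivity
  have hli : LinearIndependent ℝ M := Matrix.linearIndependent_rows_of_det_ne_zero hdet0
  let b : Module.Basis (Fin 4) ℝ (Fin 4 → ℝ) :=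
    basisOfLinearIndependentOfCardEqFinrank hli (by simp)
  have hb : ⇑b = M := coe_basisOfLinearIndependentOfCardEqFinrank hli (by simp)
  obtain ⟨ρ, hρ0, hρ⟩ : ∃ ρ : ℝ, 0 < ρ ∧ ρ ^ 4 = 10 * p := by
    refine ⟨√√(10 * p), by positivity, ?_⟩
    have : √√(10 * (p : ℝ)) ^ 4 = (√√(10 * (p : ℝ)) ^ 2) ^ 2 := by ring
    rw [this, Real.sq_sqrt (by positivity), Real.sq_sqrt (by positivity)]
  let S : Set (Fin 4 → ℝ) := {x | (∑ i, |x i| ^ (2 : ℝ)) ^ (1 / (2 : ℝ)) < ρ}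
  have hS : ∀ x, x ∈ S ↔ ∑ i, (x i) ^ 2 < ρ ^ 2 := by
    intro x
    simp only [S, Set.mem_ofPred_eq, Real.rpow_two, sq_abs]
    rw [← Real.sqrt_eq_rpow, Real.sqrt_lt' hρ0]
  have hvol : volume S = ENNReal.ofReal (5 * p * Real.pi ^ 2) := by
    have h := MeasureTheory.volume_sum_rpow_lt (ι := Fin 4) (p := 2) (by norm_num) ρ
    rw [show volume S = _ from h]
    have g1 : Real.Gamma (1 / 2 + 1) = √Real.pi / 2 := by
      rw [Real.Gamma_add_one (by norm_num), Real.Gamma_one_half_eq]; ring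
    have g2 : Real.Gamma (((Fintype.card (Fin 4) : ℕ) : ℝ) / 2 + 1) = 2 := by
      have := Real.Gamma_nat_eq_factorial 2
      rw [Fintype.card_fin]
      norm_num at this ⊢
    rw [g1, g2, ← ENNReal.ofReal_pow hρ0.le, ← ENNReal.ofReal_mul (by positivity)]
    congr 1
    rw [Fintype.card_fin, hρ]
    have : (2 * (√Real.pi / 2)) ^ 4 = (√Real.pi ^ 2) ^ 2 := by ring
    rw [this, Real.sq_sqrt Real.pi_pos.le]
    ring
  have hconv : Convex ℝ S := by
    have : S = {x | x ∈ Set.univ ∧ ∑ i, (x i) ^ 2 < ρ ^ 2} := by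
      ext x; simp [hS]
    rw [this]
    refine ConvexOn.convex_lt (f := fun x : Fin 4 → ℝ => ∑ i, (x i) ^ 2) ?_ _
    refine ⟨convex_univ, fun x _ y _ u v hu hv huv => ?_⟩
    simp only [Fin.sum_univ_four, Pi.add_apply, Pi.smul_apply, smul_eq_mul]
    have key : ∀ s t : ℝ, (u * s + v * t) ^ 2 ≤ u * s ^ 2 + v * t ^ 2 := by
      intro s t
      obtain rfl : v = 1 - u := by linarith
      nlinarith [mul_nonneg (mul_nonneg hu hv) (sq_nonneg (s - t))]
    have := key (x 0) (y 0)
    have := key (x 1) (y 1)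
    have := key (x 2) (y 2)
    have := key (x 3) (y 3)
    linarith
  have hfd := ZSpan.isAddFundamentalDomain' b (volume : Measure (Fin 4 → ℝ))
  have : Countable (Submodule.span ℤ (Set.range b)).toAddSubgroup :=
    inferInstanceAs (Countable (Submodule.span ℤ (Set.range b)))
  obtain ⟨x, hx0, hxS⟩ := exists_ne_zero_mem_lattice_of_measure_mul_two_pow_lt_measure hfd
    (s := S) (fun x hx => by rw [hS] at hx ⊢; simpa using hx) hconv (by
      rw [hvol, ZSpan.volume_fundamentalDomain, hb]
      have : (Matrix.of M).det = p * √2 ^ 3 := hdet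
      rw [this, abs_of_pos (by positivity)]
      have h16 : (2 : ENNReal) ^ Module.finrank ℝ (Fin 4 → ℝ) = ENNReal.ofReal 16 := by
        simp; norm_num
      rw [h16, ← ENNReal.ofReal_mul (by positivity)]
      apply (ENNReal.ofReal_lt_ofReal_iff (by positivity)).2
      have hpi : 3.14 < Real.pi := Real.pi_gt_d2
      have hpi2 : (9.85 : ℝ) < Real.pi ^ 2 := by nlinarith
      have h3 : √2 ^ 3 = 2 * √2 := by rw [pow_succ, hs]
      have h2 : √2 < 1.42 := by
        rw [Real.sqrt_lt' (by norm_num)]; norm_num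
      rw [h3]
      nlinarith)
  obtain ⟨x, hx⟩ := x
  have hx' : x ∈ Submodule.span ℤ (Set.range b) := hx
  rw [Submodule.mem_span_range_iff_exists_fun] at hx'
  obtain ⟨c, hc⟩ := hx'
  simp only [hb] at hc
  have hS' : x ∈ S := hxS
  rw [hS] at hS'
  have x0 : x 0 = ((c 0 * p - c 1 * r1 - c 2 * r2 - c 3 * r3 : ℤ) : ℝ) := by
    rw [← hc]; simp [Fin.sum_univ_four, M]; ring
  have x1 : x 1 = c 1 * √2 := by
    rw [← hc]; simp [Fin.sum_univ_four, M]
  have x2 : x 2 = c 2 * √2 := by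
    rw [← hc]; simp [Fin.sum_univ_four, M]
  have x3 : x 3 = c 3 * √2 := by
    rw [← hc]; simp [Fin.sum_univ_four, M]
  set a0 := c 0 * p - c 1 * r1 - c 2 * r2 - c 3 * r3 with ha0
  refine ⟨a0, c 1, c 2, c 3, ?_, ⟨c 0, by rw [ha0]; ring⟩, ?_⟩
  · rintro ⟨h0, h1, h2, h3⟩
    apply hx0
    ext i
    change x i = 0
    fin_cases i
    · simp [x0, h0]
    · simp [x1, h1]
    · simp [x2, h2]
    · simp [x3, h3]
  · rw [Fin.sum_univ_four, x0, x1, x2, x3] at hS'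
    simp only [mul_pow, hs] at hS'
    have h1 : ((a0 : ℝ) ^ 2 + 2 * c 1 ^ 2 + 2 * c 2 ^ 2 + 2 * c 3 ^ 2) ^ 2 < (ρ ^ 2) ^ 2 := by
      apply pow_lt_pow_left₀ _ (by positivity) (by norm_num)
      linarith
    rw [← pow_mul, hρ] at h1
    exact_mod_cast h1

theorem exists_norm (p : ℕ) [Fact p.Prime] (hp16 : p % 16 = 15) :
    ∃ b0 b1 b2 b3 : ℤ, (nQ b0 b1 b2 b3 = p ∨ nQ b0 b1 b2 b3 = -p) := by
  obtain ⟨r, hr⟩ := exists_root_zmod p hp16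
  obtain ⟨m, rfl⟩ := ZMod.intCast_surjective r
  obtain ⟨a0, a1, a2, a3, hne, hdvd, hlt⟩ := minkowski_four p m (m ^ 2 - 2) (m ^ 3 - 3 * m)
    (by exact_mod_cast (Fact.out : p.Prime).pos)
  have hev : evQ (a0 : ZMod p) a1 a2 a3 m = 0 := by
    rw [← ZMod.intCast_zmod_eq_zero_iff_dvd] at hdvd
    rw [← hdvd, evQ]; push_cast; ring
  have h := evQ_prod (a0 : ZMod p) a1 a2 a3 hr
  rw [hev, zero_mul] at h
  have hd : (p : ℤ) ∣ nQ a0 a1 a2 a3 := by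
    rw [← ZMod.intCast_zmod_eq_zero_iff_dvd, h]
    simp [nQ, nA, nB]
  obtain ⟨c, hc⟩ := hd
  have hle := nQ_le a0 a1 a2 a3
  have hp0 : (0 : ℤ) < p := by exact_mod_cast (Fact.out : p.Prime).pos
  refine nQ_descent p (by omega) c.natAbs c a0 a1 a2 a3 rfl ?_ ?_ (by rw [hc, mul_comm])
  · have : (p : ℤ) * |c| < p * 10 := by
      rw [hc, abs_mul, abs_of_pos hp0] at hle
      linarith
    have := lt_of_mul_lt_mul_left this hp0.le
    rw [abs_lt] at this
    omega
  · rintro rfl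
    exact hne (nQ_ne_zero _ _ _ _ (by simpa using hc))

end TwoRank

namespace TwoRank
open scoped nonZeroDivisors

/-- multiplication in `ℤ[θ]`, coordinates -/
def m0 (a0 a1 a2 a3 b0 b1 b2 b3 : ℤ) : ℤ := a0*b0+2*a1*b1+2*a2*b2+2*a3*b3
/-- multiplication in `ℤ[θ]`, coordinates -/
def m1 (a0 a1 a2 a3 b0 b1 b2 b3 : ℤ) : ℤ := a0*b1+a1*b0+a1*b2+a2*b1+a2*b3+a3*b2
/-- multiplication in `ℤ[θ]`, coordinates -/
def m2 (a0 a1 a2 a3 b0 b1 b2 b3 : ℤ) : ℤ := a0*b2+a2*b0+a1*b1-a3*b3+a1*b3+a3*b1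
/-- multiplication in `ℤ[θ]`, coordinates -/
def m3 (a0 a1 a2 a3 b0 b1 b2 b3 : ℤ) : ℤ := a0*b3+a3*b0+a1*b2+a2*b1-a2*b3-a3*b2

theorem nQ_mul (a0 a1 a2 a3 b0 b1 b2 b3 : ℤ) :
    nQ (m0 a0 a1 a2 a3 b0 b1 b2 b3) (m1 a0 a1 a2 a3 b0 b1 b2 b3) (m2 a0 a1 a2 a3 b0 b1 b2 b3)
      (m3 a0 a1 a2 a3 b0 b1 b2 b3) = nQ a0 a1 a2 a3 * nQ b0 b1 b2 b3 := by
  simp only [nQ, nA, nB, m0, m1, m2, m3]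
  ring

/-- representatives of units modulo squares -/
def uList : List (ℤ × ℤ × ℤ × ℤ) :=
  [(1, 0, 0, 0), (-1, 0, 0, 0), (1, 1, 0, 0), (-1, -1, 0, 0), (1, 0, 0, 1), (-1, 0, 0, -1),
   (1, 1, 1, 1), (-1, -1, -1, -1), (1, 0, 1, 0), (-1, 0, -1, 0), (1, 2, 1, 1), (-1, -2, -1, -1),
   (1, 1, 1, 0), (-1, -1, -1, 0), (3, 3, 2, 1), (-3, -3, -2, -1)]

/-- the bits of odd elements modulo 2 -/
def sList : List (ℤ × ℤ × ℤ × ℤ) :=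
  [(1, 0, 0, 0), (1, 0, 0, 1), (1, 0, 1, 0), (1, 0, 1, 1), (1, 1, 0, 0), (1, 1, 0, 1),
   (1, 1, 1, 0), (1, 1, 1, 1)]

/-- test -/
def chk (b0 b1 b2 b3 : ℤ) : Bool :=
  uList.any fun ⟨u0, u1, u2, u3⟩ => sList.any fun ⟨s0, s1, s2, s3⟩ =>
    (m0 u0 u1 u2 u3 b0 b1 b2 b3 - m0 s0 s1 s2 s3 s0 s1 s2 s3) % 4 == 0 &&
    ((m1 u0 u1 u2 u3 b0 b1 b2 b3 - m1 s0 s1 s2 s3 s0 s1 s2 s3) % 4 == 0 &&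
    ((m2 u0 u1 u2 u3 b0 b1 b2 b3 - m2 s0 s1 s2 s3 s0 s1 s2 s3) % 4 == 0 &&
    (m3 u0 u1 u2 u3 b0 b1 b2 b3 - m3 s0 s1 s2 s3 s0 s1 s2 s3) % 4 == 0))

set_option maxRecDepth 100000 in
theorem chk_all : ∀ b0 ∈ ([1, 3] : List ℤ), ∀ b1 ∈ ([0, 1, 2, 3] : List ℤ),
    ∀ b2 ∈ ([0, 1, 2, 3] : List ℤ), ∀ b3 ∈ ([0, 1, 2, 3] : List ℤ), chk b0 b1 b2 b3 = true := by
  decide +kernel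

theorem uList_norm : ∀ u ∈ uList, nQ u.1 u.2.1 u.2.2.1 u.2.2.2 = 1 ∨ nQ u.1 u.2.1 u.2.2.1 u.2.2.2 = -1 := by
  decide

theorem unit_adjust (b0 b1 b2 b3 : ℤ) (hb : b0 % 2 = 1) : ∃ u0 u1 u2 u3 s0 s1 s2 s3 q0 q1 q2 q3 : ℤ,
    (nQ u0 u1 u2 u3 = 1 ∨ nQ u0 u1 u2 u3 = -1) ∧
    m0 u0 u1 u2 u3 b0 b1 b2 b3 = m0 s0 s1 s2 s3 s0 s1 s2 s3 + 4 * q0 ∧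
    m1 u0 u1 u2 u3 b0 b1 b2 b3 = m1 s0 s1 s2 s3 s0 s1 s2 s3 + 4 * q1 ∧
    m2 u0 u1 u2 u3 b0 b1 b2 b3 = m2 s0 s1 s2 s3 s0 s1 s2 s3 + 4 * q2 ∧
    m3 u0 u1 u2 u3 b0 b1 b2 b3 = m3 s0 s1 s2 s3 s0 s1 s2 s3 + 4 * q3 := by
  obtain ⟨x0, e0, rfl, h0⟩ : ∃ x e, b0 = 4 * x + e ∧ e ∈ ([1, 3] : List ℤ) :=
    ⟨b0 / 4, b0 % 4, by omega, by simp; omega⟩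
  obtain ⟨x1, e1, rfl, h1⟩ : ∃ x e, b1 = 4 * x + e ∧ e ∈ ([0, 1, 2, 3] : List ℤ) :=
    ⟨b1 / 4, b1 % 4, by omega, by simp; omega⟩
  obtain ⟨x2, e2, rfl, h2⟩ : ∃ x e, b2 = 4 * x + e ∧ e ∈ ([0, 1, 2, 3] : List ℤ) :=
    ⟨b2 / 4, b2 % 4, by omega, by simp; omega⟩
  obtain ⟨x3, e3, rfl, h3⟩ : ∃ x e, b3 = 4 * x + e ∧ e ∈ ([0, 1, 2, 3] : List ℤ) :=
    ⟨b3 / 4, b3 % 4, by omega, by simp; omega⟩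
  have h := chk_all e0 h0 e1 h1 e2 h2 e3 h3
  rw [chk, List.any_eq_true] at h
  obtain ⟨⟨u0, u1, u2, u3⟩, hu, h⟩ := h
  rw [List.any_eq_true] at h
  obtain ⟨⟨s0, s1, s2, s3⟩, hs, h⟩ := h
  have hn : nQ u0 u1 u2 u3 = 1 ∨ nQ u0 u1 u2 u3 = -1 := uList_norm (u0, u1, u2, u3) hu
  clear hu hs
  simp only [Bool.and_eq_true, beq_iff_eq] at h
  obtain ⟨k0, k1, k2, k3⟩ := h
  obtain ⟨y0, hy0⟩ := Int.dvd_of_emod_eq_zero k0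
  obtain ⟨y1, hy1⟩ := Int.dvd_of_emod_eq_zero k1
  obtain ⟨y2, hy2⟩ := Int.dvd_of_emod_eq_zero k2
  obtain ⟨y3, hy3⟩ := Int.dvd_of_emod_eq_zero k3
  refine ⟨u0, u1, u2, u3, s0, s1, s2, s3, y0 + m0 u0 u1 u2 u3 x0 x1 x2 x3,
    y1 + m1 u0 u1 u2 u3 x0 x1 x2 x3, y2 + m2 u0 u1 u2 u3 x0 x1 x2 x3,
    y3 + m3 u0 u1 u2 u3 x0 x1 x2 x3, hn, ?_, ?_, ?_, ?_⟩
  · rw [mul_add, ← add_assoc, ← hy0]; simp only [m0]; ring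
  · rw [mul_add, ← add_assoc, ← hy1]; simp only [m1]; ring
  · rw [mul_add, ← add_assoc, ← hy2]; simp only [m2]; ring
  · rw [mul_add, ← add_assoc, ← hy3]; simp only [m3]; ring

theorem evQ_sq {S : Type*} [CommRing S] (s0 s1 s2 s3 : ℤ) {t : S}
    (ht : t ^ 4 - 4 * t ^ 2 + 2 = 0) :
    evQ ((m0 s0 s1 s2 s3 s0 s1 s2 s3 : ℤ) : S) (m1 s0 s1 s2 s3 s0 s1 s2 s3 : ℤ)
      (m2 s0 s1 s2 s3 s0 s1 s2 s3 : ℤ) (m3 s0 s1 s2 s3 s0 s1 s2 s3 : ℤ) t =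
      evQ (s0 : S) s1 s2 s3 t ^ 2 := by
  simp only [evQ, m0, m1, m2, m3]
  push_cast
  linear_combination (-(s2 : S) ^ 2 - 2 * s1 * s3 - 2 * t * s2 * s3 - (t ^ 2 - 2) * (s3 : S) ^ 2) * ht

/-- a prime element of `ℤ[θ]` above `p` that is a square modulo 4. -/
theorem exists_primary (p : ℕ) [Fact p.Prime] (hp16 : p % 16 = 15) :
    ∃ a0 a1 a2 a3 s0 s1 s2 s3 q0 q1 q2 q3 : ℤ, (nQ a0 a1 a2 a3 = p ∨ nQ a0 a1 a2 a3 = -p) ∧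
      a0 = m0 s0 s1 s2 s3 s0 s1 s2 s3 + 4 * q0 ∧ a1 = m1 s0 s1 s2 s3 s0 s1 s2 s3 + 4 * q1 ∧
      a2 = m2 s0 s1 s2 s3 s0 s1 s2 s3 + 4 * q2 ∧ a3 = m3 s0 s1 s2 s3 s0 s1 s2 s3 + 4 * q3 := by
  obtain ⟨b0, b1, b2, b3, hb⟩ := exists_norm p hp16
  have hodd : b0 % 2 = 1 := by
    rcases Int.emod_two_eq_zero_or_one b0 with h0 | h0
    · obtain ⟨c0, c1, c2, c3, hc⟩ := nQ_even b0 b1 b2 b3 h0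
      omega
    · exact h0
  obtain ⟨u0, u1, u2, u3, s0, s1, s2, s3, q0, q1, q2, q3, hu, h0, h1, h2, h3⟩ :=
    unit_adjust b0 b1 b2 b3 hodd
  refine ⟨_, _, _, _, s0, s1, s2, s3, q0, q1, q2, q3, ?_, h0, h1, h2, h3⟩
  rw [nQ_mul]
  rcases hb with hb | hb <;> rcases hu with hu | hu <;> rw [hb, hu] <;> simp

theorem primary_dvd {S : Type*} [CommRing S] {a0 a1 a2 a3 s0 s1 s2 s3 q0 q1 q2 q3 : ℤ}
    (h0 : a0 = m0 s0 s1 s2 s3 s0 s1 s2 s3 + 4 * q0) (h1 : a1 = m1 s0 s1 s2 s3 s0 s1 s2 s3 + 4 * q1)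
    (h2 : a2 = m2 s0 s1 s2 s3 s0 s1 s2 s3 + 4 * q2) (h3 : a3 = m3 s0 s1 s2 s3 s0 s1 s2 s3 + 4 * q3)
    {t : S} (ht : t ^ 4 - 4 * t ^ 2 + 2 = 0) :
    4 ∣ evQ (a0 : S) a1 a2 a3 t - evQ (s0 : S) s1 s2 s3 t ^ 2 := by
  refine ⟨evQ (q0 : S) q1 q2 q3 t, ?_⟩
  rw [← evQ_sq s0 s1 s2 s3 ht, h0, h1, h2, h3]
  simp only [evQ]
  push_cast
  ring

end TwoRank

namespace TwoRank
open scoped nonZeroDivisors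

theorem padic_nonsq (p : ℕ) [Fact p.Prime] (y : ℚ_[p]) : ‖y‖ ^ 2 ≠ (p : ℝ)⁻¹ := by
  intro h
  have hp1 : (1 : ℝ) < p := by exact_mod_cast (Fact.out : p.Prime).one_lt
  have hy : y ≠ 0 := by
    rintro rfl
    have : (0 : ℝ) < (p : ℝ)⁻¹ := by positivity
    simp at h
    linarith
  rw [Padic.norm_eq_zpow_neg_valuation hy, ← zpow_natCast, ← zpow_mul, ← zpow_neg_one] at h
  have := zpow_right_injective₀ (by linarith) hp1.ne' h
  push_cast at this
  omega

theorem evQ_int_root_exists (p : ℕ) [Fact p.Prime] (hp16 : p % 16 = 15) {a0 a1 a2 a3 : ℤ}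
    (hN : nQ a0 a1 a2 a3 = p ∨ nQ a0 a1 a2 a3 = -p) :
    ∃ R : ℤ_[p], R ^ 4 - 4 * R ^ 2 + 2 = 0 ∧
      ‖evQ (a0 : ℤ_[p]) a1 a2 a3 R‖ = (p : ℝ)⁻¹ ∧
      ‖evQ (a0 : ℤ_[p]) a1 a2 a3 (R ^ 3 - 3 * R)‖ = 1 ∧
      ‖evQ (a0 : ℤ_[p]) a1 a2 a3 (-R)‖ = 1 ∧
      ‖evQ (a0 : ℤ_[p]) a1 a2 a3 (-(R ^ 3 - 3 * R))‖ = 1 := by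
  have hp0 : (0 : ℝ) < p := by exact_mod_cast (Fact.out : p.Prime).pos
  have hprod : ∀ t : ℤ_[p], t ^ 4 - 4 * t ^ 2 + 2 = 0 → 
     ‖evQ (a0 : ℤ_[p]) a1 a2 a3 t‖ * (‖evQ (a0 : ℤ_[p]) a1 a2 a3 (t ^ 3 - 3 * t)‖ *
      (‖evQ (a0 : ℤ_[p]) a1 a2 a3 (-t)‖ * ‖evQ (a0 : ℤ_[p]) a1 a2 a3 (-(t ^ 3 - 3 * t))‖)) = (p : ℝ)⁻¹ := by
    intro t ht
    have h := evQ_prod (a0 : ℤ_[p]) a1 a2 a3 ht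
    have h2 : nQ (a0 : ℤ_[p]) a1 a2 a3 = ((nQ a0 a1 a2 a3 : ℤ) : ℤ_[p]) := by simp [nQ, nA, nB]
    have h3 : ‖nQ (a0 : ℤ_[p]) a1 a2 a3‖ = (p : ℝ)⁻¹ := by
      rw [h2, ← PadicInt.norm_p (p := p)]
      rcases hN with hN | hN <;> rw [hN] <;> simp
    rw [← h3, ← h]
    simp only [norm_mul]
  have key : ∀ t : ℤ_[p], t ^ 4 - 4 * t ^ 2 + 2 = 0 → ‖evQ (a0 : ℤ_[p]) a1 a2 a3 t‖ < 1 →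
      ∃ R : ℤ_[p], R ^ 4 - 4 * R ^ 2 + 2 = 0 ∧
      ‖evQ (a0 : ℤ_[p]) a1 a2 a3 R‖ = (p : ℝ)⁻¹ ∧
      ‖evQ (a0 : ℤ_[p]) a1 a2 a3 (R ^ 3 - 3 * R)‖ = 1 ∧
      ‖evQ (a0 : ℤ_[p]) a1 a2 a3 (-R)‖ = 1 ∧
      ‖evQ (a0 : ℤ_[p]) a1 a2 a3 (-(R ^ 3 - 3 * R))‖ = 1 := by
    intro t ht hlt
    have h := hprod t ht
    have hle : ‖evQ (a0 : ℤ_[p]) a1 a2 a3 t‖ ≤ (p : ℝ)⁻¹ := by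
      rw [← zpow_neg_one]
      exact (PadicInt.norm_le_pow_iff_norm_lt_pow_add_one _ _).2 (by simpa using hlt)
    have n1 := PadicInt.norm_le_one (evQ (a0 : ℤ_[p]) a1 a2 a3 (t ^ 3 - 3 * t))
    have n2 := PadicInt.norm_le_one (evQ (a0 : ℤ_[p]) a1 a2 a3 (-t))
    have n3 := PadicInt.norm_le_one (evQ (a0 : ℤ_[p]) a1 a2 a3 (-(t ^ 3 - 3 * t)))
    have m0 := norm_nonneg (evQ (a0 : ℤ_[p]) a1 a2 a3 t)
    have m1 := norm_nonneg (evQ (a0 : ℤ_[p]) a1 a2 a3 (t ^ 3 - 3 * t))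
    have m2 := norm_nonneg (evQ (a0 : ℤ_[p]) a1 a2 a3 (-t))
    have m3 := norm_nonneg (evQ (a0 : ℤ_[p]) a1 a2 a3 (-(t ^ 3 - 3 * t)))
    refine ⟨t, ht, ?_⟩
    generalize ‖evQ (a0 : ℤ_[p]) a1 a2 a3 t‖ = x0 at *
    generalize ‖evQ (a0 : ℤ_[p]) a1 a2 a3 (t ^ 3 - 3 * t)‖ = x1 at *
    generalize ‖evQ (a0 : ℤ_[p]) a1 a2 a3 (-t)‖ = x2 at *
    generalize ‖evQ (a0 : ℤ_[p]) a1 a2 a3 (-(t ^ 3 - 3 * t))‖ = x3 at *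
    have hpi : 0 < (p : ℝ)⁻¹ := by positivity
    generalize (p : ℝ)⁻¹ = P at *
    have y1 : x2 * x3 ≤ 1 := mul_le_one₀ n2 m3 n3
    have z1 : 0 ≤ x2 * x3 := by positivity
    have y2 : x1 * (x2 * x3) ≤ 1 := mul_le_one₀ n1 z1 y1
    have e0 : x0 = P := by nlinarith
    subst e0
    have e1 : x1 * (x2 * x3) = 1 := by
      have : x0 * (x1 * (x2 * x3)) = x0 * 1 := by rw [h]; ring
      exact mul_left_cancel₀ hpi.ne' this
    refine ⟨rfl, ?_, ?_, ?_⟩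
    · nlinarith
    · have : x2 * x3 = 1 := by nlinarith
      nlinarith
    · have : x2 * x3 = 1 := by nlinarith
      nlinarith
  obtain ⟨R, hR⟩ := exists_root_padic p hp16
  have hlt1 : ∀ t : ℤ_[p], t ^ 4 - 4 * t ^ 2 + 2 = 0 → ¬ ‖evQ (a0 : ℤ_[p]) a1 a2 a3 t‖ < 1 →
    ‖evQ (a0 : ℤ_[p]) a1 a2 a3 t‖ = 1 := fun t _ h => le_antisymm (PadicInt.norm_le_one _) (not_lt.1 h)
  by_contra hcon
  have k : ∀ t : ℤ_[p], t ^ 4 - 4 * t ^ 2 + 2 = 0 → ‖evQ (a0 : ℤ_[p]) a1 a2 a3 t‖ = 1 :=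
    fun t ht => hlt1 t ht fun h => hcon (key t ht h)
  have h := hprod R hR
  rw [k R hR, k _ (root_conj hR), k _ (root_neg hR), k _ (root_neg (root_conj hR))] at h
  have : (1 : ℝ) < p := by exact_mod_cast (Fact.out : p.Prime).one_lt
  have := inv_lt_one_of_one_lt₀ this
  linarith

theorem map_evQ {S T : Type*} [CommRing S] [CommRing T] (φ : S →+* T) (a0 a1 a2 a3 : ℤ) (t : S) :
    φ (evQ (a0 : S) a1 a2 a3 t) = evQ (a0 : T) a1 a2 a3 (φ t) := by
  simp [evQ, map_ofNat]

theorem evQ_field (p : ℕ) [Fact p.Prime] (hp16 : p % 16 = 15) {a0 a1 a2 a3 : ℤ}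
    (hN : nQ a0 a1 a2 a3 = p ∨ nQ a0 a1 a2 a3 = -p) {k : Type*} [Field k] (hk : (p : k) = 0)
    {t : k} (ht : t ^ 4 - 4 * t ^ 2 + 2 = 0) (h0 : evQ (a0 : k) a1 a2 a3 t = 0) :
    evQ (a0 : k) a1 a2 a3 (t ^ 3 - 3 * t) * (evQ (a0 : k) a1 a2 a3 (-t) * 
      evQ (a0 : k) a1 a2 a3 (-(t ^ 3 - 3 * t))) ≠ 0 := by
  obtain ⟨R, hR, n0, n1, n2, n3⟩ := evQ_int_root_exists p hp16 hN
  have : CharP k p := (CharP.charP_iff_prime_eq_zero Fact.out).2 hk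
  let φ : ℤ_[p] →+* k := (ZMod.castHom (m := p) dvd_rfl k).comp PadicInt.toZMod
  have hu : ∀ x : ℤ_[p], ‖x‖ = 1 → φ x ≠ 0 := fun x hx =>
    ((PadicInt.isUnit_iff.2 hx).map φ).ne_zero
  have hr : (φ R) ^ 4 - 4 * (φ R) ^ 2 + 2 = 0 := by
    have := congrArg φ hR
    simpa [map_ofNat] using this
  replace n1 := hu _ n1
  replace n2 := hu _ n2
  replace n3 := hu _ n3
  rw [map_evQ] at n1 n2 n3
  simp only [map_neg, map_sub, map_mul, map_pow, map_ofNat] at n1 n2 n3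
  set r := φ R
  have hfac : (t - r) * (t + r) * ((t - (r ^ 3 - 3 * r)) * (t + (r ^ 3 - 3 * r))) = 0 := by
    have h2 : (r ^ 3 - 3 * r) ^ 2 = 4 - r ^ 2 := by
      linear_combination (r ^ 2 - 2) * hr
    linear_combination ht - hr - (t ^ 2 - r ^ 2) * h2
  have htr : t = r := by
    rcases mul_eq_zero.1 hfac with h | h <;> rcases mul_eq_zero.1 h with h | h
    · exact sub_eq_zero.1 h
    · rw [eq_neg_of_add_eq_zero_left h] at h0; exact absurd h0 n2
    · rw [sub_eq_zero.1 h] at h0; exact absurd h0 n1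
    · rw [eq_neg_of_add_eq_zero_left h] at h0; exact absurd h0 n3
  rw [htr]
  exact mul_ne_zero n1 (mul_ne_zero n2 n3)

theorem evQ_span_sq {A : Type*} [CommRing A] [IsDedekindDomain A] (p : ℕ) [Fact p.Prime]
    (hp16 : p % 16 = 15) {a0 a1 a2 a3 : ℤ}
    (hN : nQ a0 a1 a2 a3 = p ∨ nQ a0 a1 a2 a3 = -p) (w : A) (hw : w ^ 2 = p) {t : A}
    (ht : t ^ 4 - 4 * t ^ 2 + 2 = 0) :
    ∃ I : Ideal A, Ideal.span {evQ (a0 : A) a1 a2 a3 t} = I ^ 2 := by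
  set rest := evQ (a0 : A) a1 a2 a3 (t ^ 3 - 3 * t) * (evQ (a0 : A) a1 a2 a3 (-t) * 
      evQ (a0 : A) a1 a2 a3 (-(t ^ 3 - 3 * t))) with hrest
  have hprod : evQ (a0 : A) a1 a2 a3 t * rest = ((nQ a0 a1 a2 a3 : ℤ) : A) := by
    rw [hrest, evQ_prod _ _ _ _ ht]; simp [nQ, nA, nB]
  have hcop : IsCoprime (Ideal.span {evQ (a0 : A) a1 a2 a3 t}) (Ideal.span {rest}) := by
    rw [Ideal.isCoprime_iff_sup_eq]
    by_contra hne
    obtain ⟨P, hP, hle⟩ := Ideal.exists_le_maximal _ hne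
    have h1 : evQ (a0 : A) a1 a2 a3 t ∈ P :=
      hle (Ideal.mem_sup_left (Ideal.mem_span_singleton_self _))
    have h2 : rest ∈ P :=
      hle (Ideal.mem_sup_right (Ideal.mem_span_singleton_self _))
    have h3 : (p : A) ∈ P := by
      have : ((nQ a0 a1 a2 a3 : ℤ) : A) ∈ P := hprod ▸ P.mul_mem_left _ h2
      rcases hN with hN | hN
      · rw [hN] at this; simpa using this
      · rw [hN] at this; simpa using this
    let := Ideal.Quotient.field P
    let ψ := Ideal.Quotient.mk P
    refine evQ_field (k := A ⧸ P) p hp16 hN (t := ψ t) ?_ ?_ ?_ ?_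
    · rw [← map_natCast ψ]; exact Ideal.Quotient.eq_zero_iff_mem.2 h3
    · have := congrArg ψ ht
      simpa [map_ofNat] using this
    · rw [← map_evQ]; exact Ideal.Quotient.eq_zero_iff_mem.2 h1
    · have h4 : ψ rest = 0 := Ideal.Quotient.eq_zero_iff_mem.2 h2
      rw [hrest] at h4
      simpa only [map_mul, map_evQ, map_neg, map_sub, map_pow, map_ofNat] using h4
  refine exists_eq_pow_of_mul_eq_pow_of_coprime (c := Ideal.span {w}) hcop ?_
  rw [Ideal.span_singleton_mul_span_singleton, hprod, Ideal.span_singleton_pow, hw]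
  rcases hN with hN | hN <;> rw [hN] <;> simp [Ideal.span_singleton_neg]

theorem evQ_coprime_two {A : Type*} [CommRing A] (p : ℕ) (hp16 : p % 16 = 15) {a0 a1 a2 a3 : ℤ}
    (hN : nQ a0 a1 a2 a3 = p ∨ nQ a0 a1 a2 a3 = -p) {t : A}
    (ht : t ^ 4 - 4 * t ^ 2 + 2 = 0) : IsCoprime (evQ (a0 : A) a1 a2 a3 t) 2 := by
  have hprod := evQ_prod (a0 : A) a1 a2 a3 ht
  have h2 : nQ (a0 : A) a1 a2 a3 = ((nQ a0 a1 a2 a3 : ℤ) : A) := by simp [nQ, nA, nB]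
  rw [h2] at hprod
  obtain ⟨m, hm⟩ : ∃ m, nQ a0 a1 a2 a3 = 2 * m + 1 := ⟨nQ a0 a1 a2 a3 / 2, by omega⟩
  rw [hm] at hprod
  refine ⟨evQ (a0 : A) a1 a2 a3 (t ^ 3 - 3 * t) * (evQ (a0 : A) a1 a2 a3 (-t) * 
      evQ (a0 : A) a1 a2 a3 (-(t ^ 3 - 3 * t))), -(m : A), ?_⟩
  rw [mul_comm, hprod]; push_cast; ring

end TwoRank

namespace TwoRank
open scoped nonZeroDivisors

open Polynomial in
theorem irred_f : Irreducible (X ^ 4 - 4 * X ^ 2 + 2 : ℚ[X]) := by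
  have hmonic : (X ^ 4 - 4 * X ^ 2 + 2 : ℤ[X]).Monic := by monicity!
  have hdeg : (X ^ 4 - 4 * X ^ 2 + 2 : ℤ[X]).natDegree = 4 := by compute_degree!
  have hp : (Ideal.span {(2 : ℤ)}).IsPrime := by
    rw [Ideal.span_singleton_prime (by norm_num)]; exact Int.prime_two
  have hE : (X ^ 4 - 4 * X ^ 2 + 2 : ℤ[X]).IsEisensteinAt (Ideal.span {(2 : ℤ)}) := by
    have he : (X ^ 4 - 4 * X ^ 2 + 2 : ℤ[X]) = X ^ 4 - C 4 * X ^ 2 + C 2 := by simp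
    refine hmonic.isEisensteinAt_of_mem_of_notMem hp.ne_top ?_ ?_
    · intro n hn
      rw [hdeg] at hn
      rw [he, Ideal.mem_span_singleton]
      interval_cases n <;> simp [coeff_X_pow]
    · rw [he, Ideal.span_singleton_pow, Ideal.mem_span_singleton]
      simp
  have hirr := hE.irreducible hp hmonic.isPrimitive (by rw [hdeg]; norm_num)
  have := (hmonic.irreducible_iff_irreducible_map_fraction_map (K := ℚ)).1 hirr
  simpa using this

open Polynomial in
theorem minpoly_theta {L : Type*} [Field L] [Algebra ℚ L] {θ : L}
    (hθ : θ ^ 4 - 4 * θ ^ 2 + 2 = 0) : minpoly ℚ θ = X ^ 4 - 4 * X ^ 2 + 2 := by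
  symm
  refine minpoly.eq_of_irreducible_of_monic irred_f ?_ (by monicity!)
  simpa [map_ofNat] using hθ

theorem exists_tau {L : Type*} [Field L] [Algebra ℚ L] [FiniteDimensional ℚ L] [IsGalois ℚ L] {θ : L}
    (hθ : θ ^ 4 - 4 * θ ^ 2 + 2 = 0) : ∃ τ : L ≃ₐ[ℚ] L, τ θ = θ ^ 3 - 3 * θ := by
  refine minpoly.exists_algEquiv_of_root' (Algebra.IsAlgebraic.isAlgebraic θ) ?_
  rw [minpoly_theta hθ]
  simpa [map_ofNat] using root_conj hθ

theorem eta_mem {L : Type*} [Field L] [Algebra ℚ L] [FiniteDimensional ℚ L] [IsGalois ℚ L]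
    (hcomm : ∀ σ τ : L ≃ₐ[ℚ] L, ∀ x, σ (τ x) = τ (σ x)) (E : IntermediateField ℚ L) (τ : L ≃ₐ[ℚ] L)
    (γ x : L) (hx : x ∈ E) (h : γ ^ 2 = x) : γ * τ γ ∈ E := by
  rw [← IsGalois.fixedField_fixingSubgroup E, IntermediateField.mem_fixedField_iff]
  intro σ hσ
  have hσx : σ x = x := (IntermediateField.mem_fixingSubgroup_iff E σ).1 hσ x hx
  have h1 : (σ γ) ^ 2 = γ ^ 2 := by rw [← map_pow, h, hσx]
  rw [map_mul, hcomm σ τ]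
  rcases sq_eq_sq_iff_eq_or_eq_neg.1 h1 with h2 | h2
  · rw [h2]
  · rw [h2, map_neg]; ring

theorem map_aeval_int {S T : Type*} [CommRing S] [CommRing T] (φ : S →+* T) (g : Polynomial ℤ) (s : S) :
    φ (g.aeval s) = g.aeval (φ s) :=
  (Polynomial.aeval_algHom_apply φ.toIntAlgHom s g).symm

theorem nonsq_key (p : ℕ) [Fact p.Prime] {L : Type*} [Field L] [Algebra ℚ L] [FiniteDimensional ℚ L]
    [IsGalois ℚ L] (hcomm : ∀ σ τ : L ≃ₐ[ℚ] L, ∀ x, σ (τ x) = τ (σ x)) {θ : L}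
    (hθ : θ ^ 4 - 4 * θ ^ 2 + 2 = 0) {R : ℤ_[p]} (hR : R ^ 4 - 4 * R ^ 2 + 2 = 0)
    (g : Polynomial ℤ) (hg : ‖g.aeval R * g.aeval (R ^ 3 - 3 * R)‖ = (p : ℝ)⁻¹) (γ : L) :
    γ ^ 2 ≠ g.aeval θ := by
  intro h
  obtain ⟨τ, hτ⟩ := exists_tau hθ
  let θ' : ℚ⟮θ⟯ := ⟨θ, IntermediateField.mem_adjoin_simple_self ℚ θ⟩
  have hgen : ∀ g : Polynomial ℤ, ((g.aeval θ' : ℚ⟮θ⟯) : L) = g.aeval θ := by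
    intro g
    exact map_aeval_int (algebraMap ℚ⟮θ⟯ L) g θ'
  have hmem := eta_mem hcomm ℚ⟮θ⟯ τ γ _ (by rw [← hgen]; exact Subtype.property _) h
  let η : ℚ⟮θ⟯ := ⟨γ * τ γ, hmem⟩
  have hθ' : θ' ^ 4 - 4 * θ' ^ 2 + 2 = 0 := Subtype.ext hθ
  have hη : η ^ 2 = g.aeval θ' * g.aeval (θ' ^ 3 - 3 * θ') := by
    apply Subtype.ext
    have e1 : ((g.aeval (θ' ^ 3 - 3 * θ') : ℚ⟮θ⟯) : L) = g.aeval (θ ^ 3 - 3 * θ) := 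
      map_aeval_int (algebraMap ℚ⟮θ⟯ L) g (θ' ^ 3 - 3 * θ')
    have e2 : g.aeval (θ ^ 3 - 3 * θ) = τ (g.aeval θ) := by
      rw [← hτ]
      exact (map_aeval_int (τ : L →+* L) g θ).symm
    change (γ * τ γ) ^ 2 = ((g.aeval θ' : ℚ⟮θ⟯) : L) * ((g.aeval (θ' ^ 3 - 3 * θ') : ℚ⟮θ⟯) : L)
    rw [hgen, e1, e2, ← h, map_pow]
    ring
  have hInt : IsIntegral ℚ θ := Algebra.IsIntegral.isIntegral θ
  have hroot : (R : ℚ_[p]) ∈ (minpoly ℚ θ).aroots ℚ_[p] := by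
    rw [Polynomial.mem_aroots]
    refine ⟨minpoly.ne_zero hInt, ?_⟩
    rw [minpoly_theta hθ]
    have := congrArg (algebraMap ℤ_[p] ℚ_[p]) hR
    simp only [map_add, map_sub, map_mul, map_pow, map_ofNat, map_zero] at this
    simpa [map_ofNat] using this
  let ψ : ℚ⟮θ⟯ →+* ℚ_[p] :=
    ((IntermediateField.algHomAdjoinIntegralEquiv ℚ hInt).symm ⟨(R : ℚ_[p]), hroot⟩ : _ →+* _)
  have hψ : ψ θ' = (R : ℚ_[p]) := 
    IntermediateField.algHomAdjoinIntegralEquiv_symm_apply_gen ℚ hInt ⟨(R : ℚ_[p]), hroot⟩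
  have hψg : ∀ y : ℚ⟮θ⟯, ∀ Y : ℤ_[p], ψ y = (Y : ℚ_[p]) → ψ (g.aeval y) = ((g.aeval Y : ℤ_[p]) : ℚ_[p]) := by
    intro y Y hy
    have e2 := map_aeval_int (algebraMap ℤ_[p] ℚ_[p]) g Y
    rw [map_aeval_int, hy]
    exact e2.symm
  have hfin := congrArg ψ hη
  rw [map_pow, map_mul, hψg θ' R hψ, hψg (θ' ^ 3 - 3 * θ') (R ^ 3 - 3 * R) (by
    have := map_sub (algebraMap ℤ_[p] ℚ_[p]) (R ^ 3) (3 * R)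
    rw [map_mul, map_pow, map_ofNat] at this
    rw [map_sub, map_mul, map_pow, hψ, map_ofNat]; exact this.symm)] at hfin
  have h2 := congrArg norm hfin
  rw [norm_pow] at h2
  refine padic_nonsq p (ψ η) ?_
  rw [h2, ← hg, PadicInt.norm_def]
  push_cast
  rfl

open Polynomial in
/-- the integer polynomial giving `evQ` -/
noncomputable def polQ (a0 a1 a2 a3 : ℤ) : ℤ[X] :=
  C a0 + C a1 * X + C a2 * (X ^ 2 - 2) + C a3 * (X ^ 3 - 3 * X)

theorem aeval_polQ {S : Type*} [CommRing S] (a0 a1 a2 a3 : ℤ) (t : S) :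
    (polQ a0 a1 a2 a3).aeval t = evQ (a0 : S) a1 a2 a3 t := by
  simp [polQ, evQ, map_ofNat]

theorem nonsq_one (p : ℕ) [Fact p.Prime] (hp16 : p % 16 = 15) {a0 a1 a2 a3 : ℤ}
    (hN : nQ a0 a1 a2 a3 = p ∨ nQ a0 a1 a2 a3 = -p) {L : Type*} [Field L] [Algebra ℚ L]
    [FiniteDimensional ℚ L] [IsGalois ℚ L]
    (hcomm : ∀ σ τ : L ≃ₐ[ℚ] L, ∀ x, σ (τ x) = τ (σ x)) {θ : L}
    (hθ : θ ^ 4 - 4 * θ ^ 2 + 2 = 0) (γ : L) : γ ^ 2 ≠ evQ (a0 : L) a1 a2 a3 θ := by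
  obtain ⟨R, hR, n0, n1, n2, n3⟩ := evQ_int_root_exists p hp16 hN
  rw [← aeval_polQ]
  apply nonsq_key p hcomm hθ hR
  rw [aeval_polQ, aeval_polQ, norm_mul, n0, n1, mul_one]

theorem nonsq_two (p : ℕ) [Fact p.Prime] (hp16 : p % 16 = 15) {a0 a1 a2 a3 : ℤ}
    (hN : nQ a0 a1 a2 a3 = p ∨ nQ a0 a1 a2 a3 = -p) {L : Type*} [Field L] [Algebra ℚ L]
    [FiniteDimensional ℚ L] [IsGalois ℚ L]
    (hcomm : ∀ σ τ : L ≃ₐ[ℚ] L, ∀ x, σ (τ x) = τ (σ x)) {θ : L}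
    (hθ : θ ^ 4 - 4 * θ ^ 2 + 2 = 0) (γ : L) :
    γ ^ 2 ≠ evQ (a0 : L) a1 a2 a3 θ * evQ (a0 : L) a1 a2 a3 (-θ) := by
  obtain ⟨R, hR, n0, n1, n2, n3⟩ := evQ_int_root_exists p hp16 hN
  have h : ∀ {S : Type _} [CommRing S] (t : S),
      (polQ a0 a1 a2 a3 * (polQ a0 a1 a2 a3).comp (-Polynomial.X)).aeval t =
      evQ (a0 : S) a1 a2 a3 t * evQ (a0 : S) a1 a2 a3 (-t) := by
    intro S _ t
    rw [map_mul, Polynomial.aeval_comp]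
    simp [aeval_polQ]
  have h' : ∀ (t : ℤ_[p]),
      (polQ a0 a1 a2 a3 * (polQ a0 a1 a2 a3).comp (-Polynomial.X)).aeval t =
      evQ (a0 : ℤ_[p]) a1 a2 a3 t * evQ (a0 : ℤ_[p]) a1 a2 a3 (-t) := by
    intro t
    rw [map_mul, Polynomial.aeval_comp]
    simp [aeval_polQ]
  rw [← h]
  apply nonsq_key p hcomm hθ hR
  rw [h', h', norm_mul, norm_mul, norm_mul, n0, n1, n2, n3]
  simp

end TwoRank

namespace TwoRank
open scoped nonZeroDivisors

theorem totallyComplex_of {L : Type*} [Field L] (i : L) (hi : i ^ 2 = -1) :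
    IsTotallyComplex L := by
  refine ⟨fun v => ?_⟩
  rw [← InfinitePlace.not_isReal_iff_isComplex]
  intro h
  rw [InfinitePlace.isReal_iff] at h
  have h1 : (starRingEnd ℂ) (v.embedding i) = v.embedding i := RingHom.congr_fun h i
  rw [Complex.conj_eq_iff_real] at h1
  obtain ⟨r, hr⟩ := h1
  have h2 : (v.embedding i) ^ 2 = -1 := by rw [← map_pow, hi]; simp
  rw [hr] at h2
  have h3 : r ^ 2 = -1 := by exact_mod_cast h2
  nlinarith [sq_nonneg r]

theorem core {L : Type*} [Field L] [NumberField L] [Algebra ℚ L] [FiniteDimensional ℚ L]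
    [IsGalois ℚ L] (hcomm : ∀ σ τ : L ≃ₐ[ℚ] L, ∀ x, σ (τ x) = τ (σ x))
    (p : ℕ) [Fact p.Prime] (hp16 : p % 16 = 15) (z w : L) (hz : z ^ 8 = -1) (hw : w ^ 2 = p) :
    4 ≤ Nat.card (ClassGroup (𝓞 L) ⧸ (powMonoidHom 2 : ClassGroup (𝓞 L) →* ClassGroup (𝓞 L)).range) := by
  have : IsTotallyComplex L := totallyComplex_of (z ^ 4) (by rw [← hz]; ring)
  have hθ := theta_root hz
  set θ := z + z⁻¹
  have hθint : IsIntegral ℤ θ := by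
    refine ⟨.X ^ 4 - 4 * .X ^ 2 + 2, by monicity!, ?_⟩
    have : Polynomial.eval₂ (algebraMap ℤ L) θ (.X ^ 4 - 4 * .X ^ 2 + 2) = θ ^ 4 - 4 * θ ^ 2 + 2 := by
      rw [← Polynomial.aeval_def]; simp [map_ofNat]
    rw [this, hθ]
  have hwint : IsIntegral ℤ w := by
    refine ⟨.X ^ 2 - Polynomial.C (p : ℤ), Polynomial.monic_X_pow_sub_C _ (by norm_num), ?_⟩
    simp [hw]
  let t : 𝓞 L := ⟨θ, hθint⟩
  let w' : 𝓞 L := ⟨w, hwint⟩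
  have ht : t ^ 4 - 4 * t ^ 2 + 2 = 0 := by
    apply RingOfIntegers.ext
    have e : ((t : 𝓞 L) : L) = θ := rfl
    simp only [map_add, map_sub, map_mul, map_pow, map_ofNat, map_zero, e]
    exact hθ
  have hw' : w' ^ 2 = p := by
    apply RingOfIntegers.ext
    have e : ((w' : 𝓞 L) : L) = w := rfl
    simp only [map_pow, map_natCast, e]
    exact hw
  have ht' := root_neg ht
  obtain ⟨a0, a1, a2, a3, s0, s1, s2, s3, q0, q1, q2, q3, hN, h0, h1, h2, h3⟩ := exists_primary p hp16
  obtain ⟨I, hI⟩ := evQ_span_sq p hp16 hN w' hw' ht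
  obtain ⟨J, hJ⟩ := evQ_span_sq p hp16 hN w' hw' ht'
  have c1 : ((evQ (a0 : 𝓞 L) a1 a2 a3 t : 𝓞 L) : L) = evQ (a0 : L) a1 a2 a3 θ :=
    map_evQ (algebraMap (𝓞 L) L) a0 a1 a2 a3 t
  have c2 : ((evQ (a0 : 𝓞 L) a1 a2 a3 (-t) : 𝓞 L) : L) = evQ (a0 : L) a1 a2 a3 (-θ) := by
    have := map_evQ (algebraMap (𝓞 L) L) a0 a1 a2 a3 (-t)
    rw [map_neg] at this
    exact this
  refine four_le_of (evQ (a0 : 𝓞 L) a1 a2 a3 t) (evQ (a0 : 𝓞 L) a1 a2 a3 (-t))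
    (evQ (s0 : 𝓞 L) s1 s2 s3 t) (evQ (s0 : 𝓞 L) s1 s2 s3 (-t)) ?_ ?_ ?_
    (primary_dvd h0 h1 h2 h3 ht) (primary_dvd h0 h1 h2 h3 ht') I J hI hJ
    (evQ_coprime_two p hp16 hN ht) (evQ_coprime_two p hp16 hN ht')
  · intro γ; rw [c1]; exact nonsq_one p hp16 hN hcomm hθ γ
  · intro γ; rw [c2]; exact nonsq_one p hp16 hN hcomm (root_neg hθ) γ
  · intro γ; rw [c1, c2]; exact nonsq_two p hp16 hN hcomm hθ γ

theorem adjoin_facts {F E : Type*} [Field F] [Field E] [Algebra F E] [IsAlgClosed E] (N : ℕ) [NeZero N]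
    (d : F) (S : IntermediateField F E)
    (hS : S = IntermediateField.adjoin F ({z : E | z ^ N = 1} ∪ {z : E | z ^ 2 = algebraMap F E d})) :
    FiniteDimensional F S ∧ Normal F S ∧ ∀ σ τ : S ≃ₐ[F] S, ∀ x, σ (τ x) = τ (σ x) := by
  have hset : ({z : E | z ^ N = 1} ∪ {z : E | z ^ 2 = algebraMap F E d}) =
      ((Polynomial.X ^ N - Polynomial.C 1) * (Polynomial.X ^ 2 - Polynomial.C d) : Polynomial F).rootSet E := by
    ext x
    rw [Polynomial.mem_rootSet]
    have n1 : (Polynomial.X ^ N - Polynomial.C 1 : Polynomial F) ≠ 0 :=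
      Polynomial.X_pow_sub_C_ne_zero (NeZero.pos N) _
    have n2 : (Polynomial.X ^ 2 - Polynomial.C d : Polynomial F) ≠ 0 :=
      Polynomial.X_pow_sub_C_ne_zero (by norm_num) _
    rw [and_iff_right (mul_ne_zero n1 n2)]
    simp only [Set.mem_union, Set.mem_ofPred_eq, map_mul, mul_eq_zero, map_sub, map_pow, Polynomial.aeval_X, Polynomial.aeval_C, map_one, sub_eq_zero]
  have hsplit : Polynomial.IsSplittingField F S
      ((Polynomial.X ^ N - Polynomial.C 1) * (Polynomial.X ^ 2 - Polynomial.C d) : Polynomial F) := by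
    rw [hS, hset]
    exact adjoin_rootSet_isSplittingField (IsAlgClosed.splits _)
  refine ⟨Polynomial.IsSplittingField.finiteDimensional S
    ((Polynomial.X ^ N - Polynomial.C 1) * (Polynomial.X ^ 2 - Polynomial.C d) : Polynomial F),
    Normal.of_isSplittingField
    ((Polynomial.X ^ N - Polynomial.C 1) * (Polynomial.X ^ 2 - Polynomial.C d) : Polynomial F), ?_⟩
  intro σ τ x
  have : (σ : S →ₐ[F] S).comp (τ : S →ₐ[F] S) = (τ : S →ₐ[F] S).comp (σ : S →ₐ[F] S) := by
    refine algHom_ext_of_eq_adjoin F hS ?_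
    intro y hy
    have hyS : y ∈ S := hS.ge (subset_adjoin _ _ hy)
    change σ (τ ⟨y, hyS⟩) = τ (σ ⟨y, hyS⟩)
    rcases hy with hy | hy
    · have hy' : (⟨y, hyS⟩ : S) ^ N = 1 := Subtype.ext hy
      have key : ∀ ρ : S ≃ₐ[F] S, ∃ m : ℕ, ρ ⟨y, hyS⟩ = (⟨y, hyS⟩ : S) ^ m := by
        intro ρ
        have := map_rootsOfUnity_eq_pow_self ρ (rootsOfUnity.mkOfPowEq (⟨y, hyS⟩ : S) hy')
        simpa using this
      obtain ⟨m, hm⟩ := key σ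
      obtain ⟨l, hl⟩ := key τ
      rw [hl, hm, map_pow, map_pow, hm, hl, ← pow_mul, ← pow_mul, mul_comm]
    · have hy' : (⟨y, hyS⟩ : S) ^ 2 = algebraMap F S d := Subtype.ext hy
      have key : ∀ ρ : S ≃ₐ[F] S, ρ ⟨y, hyS⟩ = (⟨y, hyS⟩ : S) ∨ ρ ⟨y, hyS⟩ = -(⟨y, hyS⟩ : S) := by
        intro ρ
        apply sq_eq_sq_iff_eq_or_eq_neg.1
        rw [← map_pow, hy', AlgEquiv.commutes]
      rcases key σ with h | h <;> rcases key τ with k | k <;> simp only [h, k, map_neg]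
  exact AlgHom.congr_fun this x

theorem numberField_of {L : Type*} [Field L] [CharZero L] [A : Algebra ℚ L] (h : FiniteDimensional ℚ L) :
    NumberField L := by
  have e : A = DivisionRing.toRatAlgebra := Subsingleton.elim _ _
  subst e
  exact @NumberField.mk L _ inferInstance h

end TwoRank

theorem twoClassGroup_Lfield_not_cyclic
    (p : ℕ) (hp : p.Prime) (hp16 : p % 16 = 15)
    (n : ℕ) (hn : 2 ≤ n) :
    ¬ IsCyclic (twoClassGroup (Lfield n (p : ℤ))) ∧
      4 ≤ Nat.card (ClassGroup (𝓞 (Lfield n (p : ℤ))) ⧸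
        (powMonoidHom 2 : ClassGroup (𝓞 (Lfield n (p : ℤ))) →*
          ClassGroup (𝓞 (Lfield n (p : ℤ)))).range) := by
  have : Fact p.Prime := ⟨hp⟩
  have hS : Lfield n (p : ℤ) = IntermediateField.adjoin ℚ
      ({z : ℂ | z ^ 2 ^ (n + 2) = 1} ∪ {z : ℂ | z ^ 2 = algebraMap ℚ ℂ (p : ℚ)}) := by
    rw [Lfield]; simp
  obtain ⟨hfd, hnorm, hcomm⟩ := TwoRank.adjoin_facts (2 ^ (n + 2)) (p : ℚ) (Lfield n (p : ℤ)) hS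
  have hNF : NumberField (Lfield n (p : ℤ)) := TwoRank.numberField_of hfd
  obtain ⟨z, hz⟩ : ∃ z : ℂ, z ^ 8 = -1 := IsAlgClosed.exists_pow_nat_eq (-1 : ℂ) (by norm_num)
  obtain ⟨w, hw⟩ : ∃ w : ℂ, w ^ 2 = (p : ℂ) := IsAlgClosed.exists_pow_nat_eq (p : ℂ) (by norm_num)
  have hzL : z ∈ Lfield n (p : ℤ) := by
    apply subset_adjoin
    left
    change z ^ 2 ^ (n + 2) = 1
    obtain ⟨k, rfl⟩ : ∃ k, n = 2 + k := ⟨n - 2, by omega⟩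
    have : 2 ^ (2 + k + 2) = 8 * (2 * 2 ^ k) := by ring
    rw [this, pow_mul, hz, pow_mul]; simp
  have hwL : w ∈ Lfield n (p : ℤ) := by
    apply subset_adjoin
    right
    change w ^ 2 = ((p : ℤ) : ℂ)
    rw [hw]; simp
  have hgal := @IsGalois.mk _ _ _ _ (Lfield n (p : ℤ)).algebra' inferInstance hnorm
  have h4 := TwoRank.core hcomm p hp16 (⟨z, hzL⟩ : Lfield n (p : ℤ)) ⟨w, hwL⟩ (Subtype.ext (by simpa using hz))
    (Subtype.ext (by simpa using hw))
  exact ⟨TwoRank.not_cyclic_of h4, h4⟩
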